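/- No consistent, Πₙ-definable and Πₙ-complete extension of Robinson arithmetic Q is Π_{n+1}-deciding: if T ⊇ Q is consistent, its set of (Gödel numbers of) axioms is definable in ℕ by a Πₙ-formula, and T proves every true Πₙ-sentence, then there exists a Π_{n+1}-sentence γ with T ⊬ γ and T ⊬ ¬γ. -/

import Mathlib

/-!
Formalization of results from "Gödel–Rosser's Incompleteness Theorems for
non-RE Theories" (Salehi & Seraji).

We work in the first-order language of arithmetic `{0, S, +, ×, ≤}` with the
standard model `ℕ`.  Provability `T ⊢ φ` is rendered as the semantic
consequence `T ⊨ᵇ φ` of Mathlib's model theory library, which by the Gödel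
completeness theorem coincides with provability in first-order logic.
-/

open FirstOrder Language BoundedFormula

namespace GRNonRE

/-- Function symbols of arithmetic: `0`, `S`, `+`, `×`. -/
inductive ArithFunc : ℕ → Type
  | zero : ArithFunc 0
  | succ : ArithFunc 1
  | add  : ArithFunc 2
  | mul  : ArithFunc 2

/-- The relation symbol `≤`. -/
inductive ArithRel : ℕ → Type
  | le : ArithRel 2

/-- The first-order language of arithmetic `{0, S, +, ×, ≤}`. -/
def LA : FirstOrder.Language := ⟨ArithFunc, ArithRel⟩

/-- The standard model `ℕ`. -/
instance : LA.Structure ℕ where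
  funMap {_} f := match f with
    | ArithFunc.zero => fun _ => 0
    | ArithFunc.succ => fun v => v 0 + 1
    | ArithFunc.add  => fun v => v 0 + v 1
    | ArithFunc.mul  => fun v => v 0 * v 1
  RelMap {_} r := match r with
    | ArithRel.le => fun v => v 0 ≤ v 1

def zeroT {α : Type} : LA.Term α := Term.func ArithFunc.zero ![]
def succT {α : Type} (t : LA.Term α) : LA.Term α := Term.func ArithFunc.succ ![t]
def addT {α : Type} (t s : LA.Term α) : LA.Term α := Term.func ArithFunc.add ![t, s]
def mulT {α : Type} (t s : LA.Term α) : LA.Term α := Term.func ArithFunc.mul ![t, s]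

/-- The atomic formula `t ≤ s`. -/
def leF {α : Type} {n : ℕ} (t s : LA.Term (α ⊕ Fin n)) : LA.BoundedFormula α n :=
  BoundedFormula.rel ArithRel.le ![t, s]

/-- The numeral `m̄ = S (S ⋯ (S 0))` representing `m : ℕ`. -/
def numeral : ℕ → LA.Term Empty
  | 0 => zeroT
  | n + 1 => succT (numeral n)

instance : Encodable (Σ n, LA.Functions n) :=
  ⟨fun f => match f with
    | ⟨_, ArithFunc.zero⟩ => 0
    | ⟨_, ArithFunc.succ⟩ => 1
    | ⟨_, ArithFunc.add⟩ => 2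
    | ⟨_, ArithFunc.mul⟩ => 3,
   fun n => match n with
    | 0 => some ⟨0, ArithFunc.zero⟩
    | 1 => some ⟨1, ArithFunc.succ⟩
    | 2 => some ⟨2, ArithFunc.add⟩
    | 3 => some ⟨2, ArithFunc.mul⟩
    | _ => none,
   by rintro ⟨n, f⟩; cases f <;> rfl⟩

instance : Encodable (Σ n, LA.Relations n) :=
  ⟨fun _ => 0,
   fun n => match n with
    | 0 => some ⟨2, ArithRel.le⟩
    | _ => none,
   by rintro ⟨n, r⟩; cases r; rfl⟩

/-- A standard Gödel numbering of formulas, obtained from Mathlib's structural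
encoding of bounded formulas as lists of symbols. -/
def godel {k : ℕ} (φ : LA.BoundedFormula Empty k) : ℕ :=
  Encodable.encode φ.listEncode

/-- Lift a term in context `k` to context `k + 1`. -/
def liftT {k : ℕ} (t : LA.Term (Empty ⊕ Fin k)) : LA.Term (Empty ⊕ Fin (k + 1)) :=
  t.relabel (Sum.map id Fin.castSucc)

/-- The class `Σ₀ = Π₀ = Δ₀` of bounded formulas: built from atomic formulas by
Boolean connectives (`⊥` and `⟹`, from which `∼`, `⊓`, `⊔` are definable) and
bounded universal quantification `∀ x ≤ t, φ` (bounded existential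
quantification `∃ x ≤ t, φ` is expressible as `∼ ∀ x ≤ t, ∼φ`). -/
inductive Delta0 : ∀ {k : ℕ}, LA.BoundedFormula Empty k → Prop
  | falsum {k : ℕ} : Delta0 (⊥ : LA.BoundedFormula Empty k)
  | equal {k : ℕ} (t₁ t₂ : LA.Term (Empty ⊕ Fin k)) : Delta0 (t₁ =' t₂)
  | le {k : ℕ} (t₁ t₂ : LA.Term (Empty ⊕ Fin k)) : Delta0 (leF t₁ t₂)
  | imp {k : ℕ} {φ ψ : LA.BoundedFormula Empty k} :
      Delta0 φ → Delta0 ψ → Delta0 (φ ⟹ ψ)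
  | bdall {k : ℕ} (t : LA.Term (Empty ⊕ Fin k)) {φ : LA.BoundedFormula Empty (k + 1)} :
      Delta0 φ → Delta0 ((leF (&(Fin.last k)) (liftT t) ⟹ φ).all)

mutual
  /-- The classes `Σₙ` of the arithmetical hierarchy: `Σ₀` is the class of
  bounded formulas, and `Σ_{n+1}` contains `Πₙ` and is closed under `⊓`, `⊔`,
  existential quantification and bounded universal quantification. -/
  inductive IsSigma : ℕ → ∀ {k : ℕ}, LA.BoundedFormula Empty k → Prop
    | ofDelta0 {k : ℕ} {φ : LA.BoundedFormula Empty k} : Delta0 φ → IsSigma 0 φ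
    | ofPi {n k : ℕ} {φ : LA.BoundedFormula Empty k} :
        IsPi n φ → IsSigma (n + 1) φ
    | ex {n k : ℕ} {φ : LA.BoundedFormula Empty (k + 1)} :
        IsSigma (n + 1) φ → IsSigma (n + 1) φ.ex
    | inf {n k : ℕ} {φ ψ : LA.BoundedFormula Empty k} :
        IsSigma (n + 1) φ → IsSigma (n + 1) ψ → IsSigma (n + 1) (φ ⊓ ψ)
    | sup {n k : ℕ} {φ ψ : LA.BoundedFormula Empty k} :
        IsSigma (n + 1) φ → IsSigma (n + 1) ψ → IsSigma (n + 1) (φ ⊔ ψ)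
    | bdall {n k : ℕ} (t : LA.Term (Empty ⊕ Fin k))
        {φ : LA.BoundedFormula Empty (k + 1)} :
        IsSigma (n + 1) φ → IsSigma (n + 1) ((leF (&(Fin.last k)) (liftT t) ⟹ φ).all)

  /-- The classes `Πₙ` of the arithmetical hierarchy: `Π₀` is the class of
  bounded formulas, and `Π_{n+1}` contains `Σₙ` and is closed under `⊓`, `⊔`,
  universal quantification and bounded existential quantification. -/
  inductive IsPi : ℕ → ∀ {k : ℕ}, LA.BoundedFormula Empty k → Prop
    | ofDelta0 {k : ℕ} {φ : LA.BoundedFormula Empty k} : Delta0 φ → IsPi 0 φ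
    | ofSigma {n k : ℕ} {φ : LA.BoundedFormula Empty k} :
        IsSigma n φ → IsPi (n + 1) φ
    | all {n k : ℕ} {φ : LA.BoundedFormula Empty (k + 1)} :
        IsPi (n + 1) φ → IsPi (n + 1) φ.all
    | inf {n k : ℕ} {φ ψ : LA.BoundedFormula Empty k} :
        IsPi (n + 1) φ → IsPi (n + 1) ψ → IsPi (n + 1) (φ ⊓ ψ)
    | sup {n k : ℕ} {φ ψ : LA.BoundedFormula Empty k} :
        IsPi (n + 1) φ → IsPi (n + 1) ψ → IsPi (n + 1) (φ ⊔ ψ)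
    | bdex {n k : ℕ} (t : LA.Term (Empty ⊕ Fin k))
        {φ : LA.BoundedFormula Empty (k + 1)} :
        IsPi (n + 1) φ → IsPi (n + 1) ((leF (&(Fin.last k)) (liftT t) ⊓ φ).ex)
end

/-- `T ⊢ φ`: by the Gödel completeness theorem, provability of the sentence `φ`
from the theory `T` coincides with the semantic consequence relation. -/
def Proves (T : LA.Theory) (φ : LA.Sentence) : Prop := T ⊨ᵇ φ

/-- Consistency of a theory. -/
def Consistent (T : LA.Theory) : Prop := ¬ Proves T ⊥

/-- `ψ(m̄)`: the result of substituting the numeral `m̄` for the free variable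
of a formula `ψ(x)` with one free variable. -/
def subst1 (ψ : LA.BoundedFormula Empty 1) (m : ℕ) : LA.Sentence :=
  ψ.toFormula.subst fun _ => numeral m

/-- `n`-consistency: there is no formula `ψ(x) ∈ Π_{n-1}` such that `T ⊢ ¬ψ(m̄)`
for every numeral `m̄` (`m ∈ ℕ`) and yet `T ⊢ ∃x ψ(x)`.
(`0`-consistency is ordinary consistency.) -/
def NCon : ℕ → LA.Theory → Prop
  | 0, T => Consistent T
  | n + 1, T => ¬ ∃ ψ : LA.BoundedFormula Empty 1, IsPi n ψ ∧
      (∀ m : ℕ, Proves T (∼(subst1 ψ m))) ∧ Proves T ψ.ex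

/-- The axioms of Robinson arithmetic `Q`:
`Sx ≠ 0`, `Sx = Sy → x = y`, `x ≠ 0 → ∃y x = Sy`, `x + 0 = x`,
`x + Sy = S(x + y)`, `x·0 = 0`, `x·Sy = x·y + x`, `x ≤ y ↔ ∃z z + x = y`. -/
def QTheory : LA.Theory :=
  { ∀' ∼(succT (&0) =' zeroT),
    ∀' ∀' ((succT (&0) =' succT (&1)) ⟹ (&0 =' &1)),
    ∀' (∼(&0 =' zeroT) ⟹ ∃' (&0 =' succT (&1))),
    ∀' (addT (&0) zeroT =' &0),
    ∀' ∀' (addT (&0) (succT (&1)) =' succT (addT (&0) (&1))),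
    ∀' (mulT (&0) zeroT =' zeroT),
    ∀' ∀' (mulT (&0) (succT (&1)) =' addT (mulT (&0) (&1)) (&0)),
    ((leF (&0) (&1) ⇔ ∃' (addT (&2) (&0) =' (&1)) : LA.BoundedFormula Empty 2)).alls }

/-- `T` is an extension of Robinson arithmetic `Q` (i.e. `T` proves `Q`). -/
def ExtendsQ (T : LA.Theory) : Prop := ∀ φ ∈ QTheory, Proves T φ

/-- `Πₙ-Th(ℕ)`: the set of `Πₙ`-sentences true in the standard model. -/
def PiTh (n : ℕ) : LA.Theory := {φ | IsPi n φ ∧ ℕ ⊨ φ}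

/-- Soundness: every theorem of `T` is true in `ℕ`. -/
def Sound (T : LA.Theory) : Prop := ∀ φ : LA.Sentence, Proves T φ → ℕ ⊨ φ

/-- `Σₙ`-soundness: every `Σₙ`-sentence provable in `T` is true in `ℕ`. -/
def SigmaSound (n : ℕ) (T : LA.Theory) : Prop :=
  ∀ φ : LA.Sentence, IsSigma n φ → Proves T φ → ℕ ⊨ φ

/-- A formula `Ψ(x)` with one free variable defines the set `A ⊆ ℕ` in `ℕ`. -/
def Defines (Ψ : LA.BoundedFormula Empty 1) (A : Set ℕ) : Prop :=
  ∀ m : ℕ, m ∈ A ↔ Ψ.Realize (fun e => Empty.elim e) ![m]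

/-- `A ⊆ ℕ` is definable in `ℕ` by a `Σₙ`-formula. -/
def SigmaDefinable (n : ℕ) (A : Set ℕ) : Prop := ∃ Ψ, IsSigma n Ψ ∧ Defines Ψ A

/-- `A ⊆ ℕ` is definable in `ℕ` by a `Πₙ`-formula. -/
def PiDefinable (n : ℕ) (A : Set ℕ) : Prop := ∃ Ψ, IsPi n Ψ ∧ Defines Ψ A

/-- The set of Gödel numbers of the axioms of `T`. -/
def axiomCodes (T : LA.Theory) : Set ℕ := {m | ∃ φ ∈ T, godel φ = m}

/-- The set of Gödel numbers of the theorems of `T` (its deductive closure). -/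
def theoremCodes (T : LA.Theory) : Set ℕ := {m | ∃ φ, Proves T φ ∧ godel φ = m}

/-! ### Semantics of the basic symbols in arbitrary structures -/

section Semantics

variable {M : Type} [LA.Structure M]

/-- The interpretation of `0`. -/
def zeroM (M : Type) [LA.Structure M] : M := Structure.funMap (L := LA) ArithFunc.zero ![]

/-- The interpretation of the successor. -/
def succM (x : M) : M := Structure.funMap (L := LA) ArithFunc.succ ![x]

/-- The interpretation of addition. -/
def addM (x y : M) : M := Structure.funMap (L := LA) ArithFunc.add ![x, y]

/-- The interpretation of multiplication. -/
def mulM (x y : M) : M := Structure.funMap (L := LA) ArithFunc.mul ![x, y]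

/-- The interpretation of `≤`. -/
def leM (x y : M) : Prop := Structure.RelMap (L := LA) ArithRel.le ![x, y]

/-- Truth of a formula under an assignment of its free variables. -/
def Sat {k : ℕ} (φ : LA.BoundedFormula Empty k) (v : Fin k → M) : Prop :=
  φ.Realize default v

/-- The value of a term under an assignment of its free variables. -/
def evalT {k : ℕ} (t : LA.Term (Empty ⊕ Fin k)) (v : Fin k → M) : M :=
  t.realize (Sum.elim default v)

theorem funMap_zero (v : Fin 0 → M) :
    Structure.funMap (L := LA) ArithFunc.zero v = zeroM M :=
  congrArg _ (Subsingleton.elim _ _)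

theorem funMap_succ (v : Fin 1 → M) :
    Structure.funMap (L := LA) ArithFunc.succ v = succM (v 0) :=
  congrArg _ (List.ofFn_inj.mp rfl)

theorem funMap_add (v : Fin 2 → M) :
    Structure.funMap (L := LA) ArithFunc.add v = addM (v 0) (v 1) :=
  congrArg _ (List.ofFn_inj.mp rfl)

theorem funMap_mul (v : Fin 2 → M) :
    Structure.funMap (L := LA) ArithFunc.mul v = mulM (v 0) (v 1) :=
  congrArg _ (List.ofFn_inj.mp rfl)

theorem relMap_le (v : Fin 2 → M) :
    Structure.RelMap (L := LA) ArithRel.le v ↔ leM (v 0) (v 1) :=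
  iff_of_eq (congrArg _ (List.ofFn_inj.mp rfl))

@[simp] theorem realize_zeroT {α : Type} (v : α → M) : (zeroT : LA.Term α).realize v = zeroM M :=
  funMap_zero _

@[simp] theorem realize_succT {α : Type} (v : α → M) (t : LA.Term α) :
    (succT t).realize v = succM (t.realize v) := funMap_succ _

@[simp] theorem realize_addT {α : Type} (v : α → M) (t s : LA.Term α) :
    (addT t s).realize v = addM (t.realize v) (s.realize v) := funMap_add _

@[simp] theorem realize_mulT {α : Type} (v : α → M) (t s : LA.Term α) :
    (mulT t s).realize v = mulM (t.realize v) (s.realize v) := funMap_mul _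

@[simp] theorem realize_leF {α : Type} {k : ℕ} (v : α → M) (xs : Fin k → M)
    (t s : LA.Term (α ⊕ Fin k)) :
    (leF t s).Realize v xs ↔ leM (t.realize (Sum.elim v xs)) (s.realize (Sum.elim v xs)) :=
  relMap_le _

@[simp] theorem evalT_zeroT {k : ℕ} (v : Fin k → M) : evalT zeroT v = zeroM M := realize_zeroT _
@[simp] theorem evalT_succT {k : ℕ} (v : Fin k → M) (t : LA.Term (Empty ⊕ Fin k)) :
    evalT (succT t) v = succM (evalT t v) := realize_succT _ _
@[simp] theorem evalT_addT {k : ℕ} (v : Fin k → M) (t s : LA.Term (Empty ⊕ Fin k)) :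
    evalT (addT t s) v = addM (evalT t v) (evalT s v) := realize_addT _ _ _
@[simp] theorem evalT_mulT {k : ℕ} (v : Fin k → M) (t s : LA.Term (Empty ⊕ Fin k)) :
    evalT (mulT t s) v = mulM (evalT t v) (evalT s v) := realize_mulT _ _ _
@[simp] theorem evalT_var {k : ℕ} (v : Fin k → M) (i : Fin k) :
    evalT (Term.var (Sum.inr i) : LA.Term (Empty ⊕ Fin k)) v = v i := rfl

@[simp] theorem evalT_liftT {k : ℕ} (v : Fin k → M) (x : M) (t : LA.Term (Empty ⊕ Fin k)) :
    evalT (liftT t) (Fin.snoc v x : Fin (k + 1) → M) = evalT t v := by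
  simp only [evalT, liftT, Term.realize_relabel]
  congr 1
  funext i
  rcases i with i | i
  · exact i.elim
  · simp

@[simp] theorem sat_bot {k : ℕ} (v : Fin k → M) :
    Sat (⊥ : LA.BoundedFormula Empty k) v ↔ False := Iff.rfl
@[simp] theorem sat_equal {k : ℕ} (v : Fin k → M) (t s : LA.Term (Empty ⊕ Fin k)) :
    Sat (t =' s) v ↔ evalT t v = evalT s v := Iff.rfl
@[simp] theorem sat_leF {k : ℕ} (v : Fin k → M) (t s : LA.Term (Empty ⊕ Fin k)) :
    Sat (leF t s) v ↔ leM (evalT t v) (evalT s v) := realize_leF _ _ _ _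
@[simp] theorem sat_imp {k : ℕ} (v : Fin k → M) (φ ψ : LA.BoundedFormula Empty k) :
    Sat (φ ⟹ ψ) v ↔ (Sat φ v → Sat ψ v) := Iff.rfl
@[simp] theorem sat_not {k : ℕ} (v : Fin k → M) (φ : LA.BoundedFormula Empty k) :
    Sat (∼φ) v ↔ ¬ Sat φ v := Iff.rfl
@[simp] theorem sat_inf {k : ℕ} (v : Fin k → M) (φ ψ : LA.BoundedFormula Empty k) :
    Sat (φ ⊓ ψ) v ↔ Sat φ v ∧ Sat ψ v := realize_inf
@[simp] theorem sat_sup {k : ℕ} (v : Fin k → M) (φ ψ : LA.BoundedFormula Empty k) :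
    Sat (φ ⊔ ψ) v ↔ Sat φ v ∨ Sat ψ v := realize_sup
@[simp] theorem sat_all {k : ℕ} (v : Fin k → M) (φ : LA.BoundedFormula Empty (k + 1)) :
    Sat φ.all v ↔ ∀ x : M, Sat φ (Fin.snoc v x : Fin (k + 1) → M) := Iff.rfl
@[simp] theorem sat_ex {k : ℕ} (v : Fin k → M) (φ : LA.BoundedFormula Empty (k + 1)) :
    Sat φ.ex v ↔ ∃ x : M, Sat φ (Fin.snoc v x : Fin (k + 1) → M) := realize_ex

end Semantics

/-! ### Substitution of terms for variables -/

/-- Substitute terms for the variables of a term. -/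
def substT {k m : ℕ} (σ : Fin k → LA.Term (Empty ⊕ Fin m)) (t : LA.Term (Empty ⊕ Fin k)) :
    LA.Term (Empty ⊕ Fin m) :=
  t.subst (Sum.elim (fun e => e.elim) σ)

@[simp] theorem evalT_substT {M : Type} [LA.Structure M] {k m : ℕ}
    (σ : Fin k → LA.Term (Empty ⊕ Fin m)) (t : LA.Term (Empty ⊕ Fin k)) (v : Fin m → M) :
    evalT (substT σ t) v = evalT t (fun i => evalT (σ i) v) := by
  simp only [evalT, substT, Term.realize_subst]
  congr 1
  funext i
  rcases i with i | i
  · exact i.elim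
  · rfl

/-- Extend a substitution below a quantifier. -/
def liftSubst {k m : ℕ} (σ : Fin k → LA.Term (Empty ⊕ Fin m)) :
    Fin (k + 1) → LA.Term (Empty ⊕ Fin (m + 1)) :=
  Fin.snoc (fun i => liftT (σ i)) (&(Fin.last m))

theorem evalT_liftSubst {M : Type} [LA.Structure M] {k m : ℕ}
    (σ : Fin k → LA.Term (Empty ⊕ Fin m)) (v : Fin m → M) (x : M) :
    (fun i => evalT (liftSubst σ i) (Fin.snoc v x : Fin (m + 1) → M)) =
      (Fin.snoc (fun i => evalT (σ i) v) x : Fin (k + 1) → M) := by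
  funext i
  refine Fin.lastCases ?_ (fun i => ?_) i
  · simp [liftSubst]
  · simp [liftSubst]

/-- `φ'` is a substitution instance of `φ` along `σ`, up to logical equivalence. -/
def IsSubst {k m : ℕ} (σ : Fin k → LA.Term (Empty ⊕ Fin m)) (φ : LA.BoundedFormula Empty k)
    (φ' : LA.BoundedFormula Empty m) : Prop :=
  ∀ (M : Type) [LA.Structure M] (v : Fin m → M), Sat φ' v ↔ Sat φ (fun i => evalT (σ i) v)

theorem Delta0.exists_subst {k : ℕ} {φ : LA.BoundedFormula Empty k} (h : Delta0 φ) :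
    ∀ {m : ℕ} (σ : Fin k → LA.Term (Empty ⊕ Fin m)), ∃ φ', Delta0 φ' ∧ IsSubst σ φ φ' := by
  induction h with
  | falsum => exact fun σ => ⟨⊥, .falsum, fun M _ v => by simp⟩
  | equal t₁ t₂ => exact fun σ => ⟨_, .equal (substT σ t₁) (substT σ t₂), fun M _ v => by simp⟩
  | le t₁ t₂ => exact fun σ => ⟨_, .le (substT σ t₁) (substT σ t₂), fun M _ v => by simp⟩
  | imp _ _ ih₁ ih₂ =>
    intro m σ
    obtain ⟨φ₁, h₁, e₁⟩ := ih₁ σ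
    obtain ⟨φ₂, h₂, e₂⟩ := ih₂ σ
    exact ⟨_, h₁.imp h₂, fun M _ v => by simp [e₁ M v, e₂ M v]⟩
  | bdall t _ ih =>
    intro m σ
    obtain ⟨φ₁, h₁, e₁⟩ := ih (liftSubst σ)
    exact ⟨_, h₁.bdall (substT σ t), fun M _ v => by simp [e₁ M, evalT_liftSubst]⟩

/-- Simultaneous induction over the classes `Σₙ` and `Πₙ`. -/
theorem sigma_pi_induction {S P : ℕ → ∀ {k : ℕ}, LA.BoundedFormula Empty k → Prop}
    (delta_sigma : ∀ {k} {φ : LA.BoundedFormula Empty k}, Delta0 φ → S 0 φ)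
    (pi_sigma : ∀ {n k} {φ : LA.BoundedFormula Empty k}, P n φ → S (n + 1) φ)
    (ex : ∀ {n k} {φ : LA.BoundedFormula Empty (k + 1)}, S (n + 1) φ → S (n + 1) φ.ex)
    (inf_sigma : ∀ {n k} {φ ψ : LA.BoundedFormula Empty k},
      S (n + 1) φ → S (n + 1) ψ → S (n + 1) (φ ⊓ ψ))
    (sup_sigma : ∀ {n k} {φ ψ : LA.BoundedFormula Empty k},
      S (n + 1) φ → S (n + 1) ψ → S (n + 1) (φ ⊔ ψ))
    (bdall : ∀ {n k} (t : LA.Term (Empty ⊕ Fin k)) {φ : LA.BoundedFormula Empty (k + 1)},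
      S (n + 1) φ → S (n + 1) ((leF (&(Fin.last k)) (liftT t) ⟹ φ).all))
    (delta_pi : ∀ {k} {φ : LA.BoundedFormula Empty k}, Delta0 φ → P 0 φ)
    (sigma_pi : ∀ {n k} {φ : LA.BoundedFormula Empty k}, S n φ → P (n + 1) φ)
    (all : ∀ {n k} {φ : LA.BoundedFormula Empty (k + 1)}, P (n + 1) φ → P (n + 1) φ.all)
    (inf_pi : ∀ {n k} {φ ψ : LA.BoundedFormula Empty k},
      P (n + 1) φ → P (n + 1) ψ → P (n + 1) (φ ⊓ ψ))
    (sup_pi : ∀ {n k} {φ ψ : LA.BoundedFormula Empty k},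
      P (n + 1) φ → P (n + 1) ψ → P (n + 1) (φ ⊔ ψ))
    (bdex : ∀ {n k} (t : LA.Term (Empty ⊕ Fin k)) {φ : LA.BoundedFormula Empty (k + 1)},
      P (n + 1) φ → P (n + 1) ((leF (&(Fin.last k)) (liftT t) ⊓ φ).ex)) :
    (∀ {n k} {φ : LA.BoundedFormula Empty k}, IsSigma n φ → S n φ) ∧
      (∀ {n k} {φ : LA.BoundedFormula Empty k}, IsPi n φ → P n φ) :=
  ⟨fun h => IsSigma.rec (motive_1 := fun n _ φ _ => S n φ) (motive_2 := fun n _ φ _ => P n φ)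
      delta_sigma (fun _ => pi_sigma) (fun _ => ex) (fun _ _ => inf_sigma) (fun _ _ => sup_sigma)
      (fun t _ _ => bdall t) delta_pi (fun _ => sigma_pi) (fun _ => all) (fun _ _ => inf_pi)
      (fun _ _ => sup_pi) (fun t _ _ => bdex t) h,
    fun h => IsPi.rec (motive_1 := fun n _ φ _ => S n φ) (motive_2 := fun n _ φ _ => P n φ)
      delta_sigma (fun _ => pi_sigma) (fun _ => ex) (fun _ _ => inf_sigma) (fun _ _ => sup_sigma)
      (fun t _ _ => bdall t) delta_pi (fun _ => sigma_pi) (fun _ => all) (fun _ _ => inf_pi)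
      (fun _ _ => sup_pi) (fun t _ _ => bdex t) h⟩

theorem sigma_pi_exists_subst :
    (∀ {n k : ℕ} {φ : LA.BoundedFormula Empty k}, IsSigma n φ →
      ∀ {m : ℕ} (σ : Fin k → LA.Term (Empty ⊕ Fin m)), ∃ φ', IsSigma n φ' ∧ IsSubst σ φ φ') ∧
    (∀ {n k : ℕ} {φ : LA.BoundedFormula Empty k}, IsPi n φ →
      ∀ {m : ℕ} (σ : Fin k → LA.Term (Empty ⊕ Fin m)), ∃ φ', IsPi n φ' ∧ IsSubst σ φ φ') := by
  apply sigma_pi_induction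
    (S := fun n k φ => ∀ {m : ℕ} (σ : Fin k → LA.Term (Empty ⊕ Fin m)),
      ∃ φ', IsSigma n φ' ∧ IsSubst σ φ φ')
    (P := fun n k φ => ∀ {m : ℕ} (σ : Fin k → LA.Term (Empty ⊕ Fin m)),
      ∃ φ', IsPi n φ' ∧ IsSubst σ φ φ')
  case delta_sigma =>
    intro k φ h m σ
    obtain ⟨φ', h', e⟩ := h.exists_subst σ
    exact ⟨φ', .ofDelta0 h', e⟩
  case delta_pi =>
    intro k φ h m σ
    obtain ⟨φ', h', e⟩ := h.exists_subst σ
    exact ⟨φ', .ofDelta0 h', e⟩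
  case pi_sigma =>
    intro n k φ ih m σ
    obtain ⟨φ', h', e⟩ := ih σ
    exact ⟨φ', .ofPi h', e⟩
  case sigma_pi =>
    intro n k φ ih m σ
    obtain ⟨φ', h', e⟩ := ih σ
    exact ⟨φ', .ofSigma h', e⟩
  case ex =>
    intro n k φ ih m σ
    obtain ⟨φ', h', e⟩ := ih (liftSubst σ)
    exact ⟨_, h'.ex, fun M _ v => by simp [e M, evalT_liftSubst]⟩
  case all =>
    intro n k φ ih m σ
    obtain ⟨φ', h', e⟩ := ih (liftSubst σ)
    exact ⟨_, h'.all, fun M _ v => by simp [e M, evalT_liftSubst]⟩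
  case inf_sigma | inf_pi =>
    intro n k φ ψ ih₁ ih₂ m σ
    obtain ⟨φ₁, h₁, e₁⟩ := ih₁ σ
    obtain ⟨φ₂, h₂, e₂⟩ := ih₂ σ
    exact ⟨_, h₁.inf h₂, fun M _ v => by simp [e₁ M v, e₂ M v]⟩
  case sup_sigma | sup_pi =>
    intro n k φ ψ ih₁ ih₂ m σ
    obtain ⟨φ₁, h₁, e₁⟩ := ih₁ σ
    obtain ⟨φ₂, h₂, e₂⟩ := ih₂ σ
    exact ⟨_, h₁.sup h₂, fun M _ v => by simp [e₁ M v, e₂ M v]⟩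
  case bdall =>
    intro n k t φ ih m σ
    obtain ⟨φ', h', e⟩ := ih (liftSubst σ)
    exact ⟨_, h'.bdall (substT σ t), fun M _ v => by simp [e M, evalT_liftSubst]⟩
  case bdex =>
    intro n k t φ ih m σ
    obtain ⟨φ', h', e⟩ := ih (liftSubst σ)
    exact ⟨_, h'.bdex (substT σ t), fun M _ v => by simp [e M, evalT_liftSubst]⟩

theorem IsPi.exists_subst {n k : ℕ} {φ : LA.BoundedFormula Empty k} (h : IsPi n φ)
    {m : ℕ} (σ : Fin k → LA.Term (Empty ⊕ Fin m)) : ∃ φ', IsPi n φ' ∧ IsSubst σ φ φ' :=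
  sigma_pi_exists_subst.2 h σ

/-! ### Negations and inclusions between the classes -/

/-- `φ'` is logically equivalent to the negation of `φ`. -/
def IsNeg {k : ℕ} (φ φ' : LA.BoundedFormula Empty k) : Prop :=
  ∀ (M : Type) [LA.Structure M] (v : Fin k → M), Sat φ' v ↔ ¬ Sat φ v

theorem sigma_pi_exists_neg :
    (∀ {n k : ℕ} {φ : LA.BoundedFormula Empty k}, IsSigma n φ →
      ∃ φ', IsPi n φ' ∧ IsNeg φ φ') ∧
    (∀ {n k : ℕ} {φ : LA.BoundedFormula Empty k}, IsPi n φ →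
      ∃ φ', IsSigma n φ' ∧ IsNeg φ φ') := by
  apply sigma_pi_induction (S := fun n _ φ => ∃ φ', IsPi n φ' ∧ IsNeg φ φ')
    (P := fun n _ φ => ∃ φ', IsSigma n φ' ∧ IsNeg φ φ')
  case delta_sigma =>
    exact fun {k φ} h => ⟨∼φ, .ofDelta0 (h.imp .falsum), fun M _ v => by simp⟩
  case delta_pi =>
    exact fun {k φ} h => ⟨∼φ, .ofDelta0 (h.imp .falsum), fun M _ v => by simp⟩
  case pi_sigma => exact fun ⟨φ', h', e⟩ => ⟨φ', .ofSigma h', e⟩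
  case sigma_pi => exact fun ⟨φ', h', e⟩ => ⟨φ', .ofPi h', e⟩
  case ex => exact fun ⟨φ', h', e⟩ => ⟨_, h'.all, fun M _ v => by simp [e M]⟩
  case all => exact fun ⟨φ', h', e⟩ => ⟨_, h'.ex, fun M _ v => by simp [e M]⟩
  case inf_sigma | inf_pi =>
    exact fun ⟨φ₁, h₁, e₁⟩ ⟨φ₂, h₂, e₂⟩ => ⟨_, h₁.sup h₂, fun M _ v => by
      simp only [sat_sup, sat_inf, e₁ M v, e₂ M v]; tauto⟩
  case sup_sigma | sup_pi =>
    exact fun ⟨φ₁, h₁, e₁⟩ ⟨φ₂, h₂, e₂⟩ => ⟨_, h₁.inf h₂, fun M _ v => by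
      simp [e₁ M v, e₂ M v]⟩
  case bdall => exact fun t _ ⟨φ', h', e⟩ => ⟨_, h'.bdex t, fun M _ v => by simp [e M]⟩
  case bdex => exact fun t _ ⟨φ', h', e⟩ => ⟨_, h'.bdall t, fun M _ v => by simp [e M]⟩

theorem Delta0.isSigma_isPi {k : ℕ} {φ : LA.BoundedFormula Empty k} (h : Delta0 φ) (n : ℕ) :
    IsSigma n φ ∧ IsPi n φ := by
  induction n with
  | zero => exact ⟨.ofDelta0 h, .ofDelta0 h⟩
  | succ n ih => exact ⟨.ofPi ih.2, .ofSigma ih.1⟩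

theorem sigma_pi_succ :
    (∀ {n k : ℕ} {φ : LA.BoundedFormula Empty k}, IsSigma n φ → IsSigma (n + 1) φ) ∧
    (∀ {n k : ℕ} {φ : LA.BoundedFormula Empty k}, IsPi n φ → IsPi (n + 1) φ) := by
  apply sigma_pi_induction (S := fun n _ φ => IsSigma (n + 1) φ) (P := fun n _ φ => IsPi (n + 1) φ)
  case delta_sigma => exact fun h => (h.isSigma_isPi _).1
  case delta_pi => exact fun h => (h.isSigma_isPi _).2
  case pi_sigma => exact .ofPi
  case sigma_pi => exact .ofSigma
  case ex => exact .ex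
  case all => exact .all
  case inf_sigma => exact .inf
  case inf_pi => exact .inf
  case sup_sigma => exact .sup
  case sup_pi => exact .sup
  case bdall => exact .bdall
  case bdex => exact .bdex

theorem IsPi.succ {n k : ℕ} {φ : LA.BoundedFormula Empty k} (h : IsPi n φ) : IsPi (n + 1) φ :=
  sigma_pi_succ.2 h

/-! ### Definability in the standard model -/

@[simp] theorem zeroM_nat : zeroM ℕ = 0 := rfl
@[simp] theorem succM_nat (x : ℕ) : succM x = x + 1 := rfl
@[simp] theorem addM_nat (x y : ℕ) : addM x y = x + y := rfl
@[simp] theorem mulM_nat (x y : ℕ) : mulM x y = x * y := rfl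
@[simp] theorem leM_nat (x y : ℕ) : leM x y ↔ x ≤ y := Iff.rfl

/-- The `i`-th variable as a term. -/
def varT {k : ℕ} (i : Fin k) : LA.Term (Empty ⊕ Fin k) := Term.var (Sum.inr i)

@[simp] theorem evalT_varT {M : Type} [LA.Structure M] {k : ℕ} (v : Fin k → M) (i : Fin k) :
    evalT (varT i) v = v i := rfl

section PiFormulas

variable {n k : ℕ}

theorem IsPi.exists_inf {φ ψ : LA.BoundedFormula Empty k} (hφ : IsPi n φ) (hψ : IsPi n ψ) :
    ∃ χ : LA.BoundedFormula Empty k, IsPi n χ ∧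
      ∀ v : Fin k → ℕ, Sat χ v ↔ Sat φ v ∧ Sat ψ v := by
  cases n with
  | zero =>
    cases hφ with | ofDelta0 h₁ => cases hψ with | ofDelta0 h₂ =>
    exact ⟨φ ⊓ ψ, .ofDelta0 ((h₁.imp (h₂.imp .falsum)).imp .falsum), fun v => by simp⟩
  | succ n => exact ⟨_, hφ.inf hψ, fun v => by simp⟩

theorem IsPi.exists_sup {φ ψ : LA.BoundedFormula Empty k} (hφ : IsPi n φ) (hψ : IsPi n ψ) :
    ∃ χ : LA.BoundedFormula Empty k, IsPi n χ ∧
      ∀ v : Fin k → ℕ, Sat χ v ↔ Sat φ v ∨ Sat ψ v := by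
  cases n with
  | zero =>
    cases hφ with | ofDelta0 h₁ => cases hψ with | ofDelta0 h₂ =>
    exact ⟨φ ⊔ ψ, .ofDelta0 ((h₁.imp .falsum).imp h₂), fun v => by simp⟩
  | succ n => exact ⟨_, hφ.sup hψ, fun v => by simp⟩

theorem IsPi.exists_bdall {φ : LA.BoundedFormula Empty (k + 1)} (hφ : IsPi n φ)
    (t : LA.Term (Empty ⊕ Fin k)) :
    ∃ χ : LA.BoundedFormula Empty k, IsPi n χ ∧
      ∀ v : Fin k → ℕ, Sat χ v ↔ ∀ x ≤ evalT t v, Sat φ (Fin.snoc v x : Fin (k + 1) → ℕ) := by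
  cases n with
  | zero =>
    cases hφ with | ofDelta0 h₁ =>
    exact ⟨_, .ofDelta0 (h₁.bdall t), fun v => by simp⟩
  | succ n =>
    refine ⟨_, ((Delta0.isSigma_isPi ((Delta0.le (varT (Fin.last k)) (liftT t)).imp .falsum)
      _).2.sup hφ).all, fun v => ?_⟩
    change Sat (∼(leF (varT (Fin.last k)) (liftT t)) ⊔ φ).all v ↔ _
    simp [imp_iff_not_or]

theorem IsPi.exists_bdex {φ : LA.BoundedFormula Empty (k + 1)} (hφ : IsPi n φ)
    (t : LA.Term (Empty ⊕ Fin k)) :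
    ∃ χ : LA.BoundedFormula Empty k, IsPi n χ ∧
      ∀ v : Fin k → ℕ, Sat χ v ↔ ∃ x ≤ evalT t v, Sat φ (Fin.snoc v x : Fin (k + 1) → ℕ) := by
  cases n with
  | zero =>
    cases hφ with | ofDelta0 h₁ =>
    exact ⟨_, .ofDelta0 (((h₁.imp .falsum).bdall t).imp .falsum), fun v => by
      change Sat (∼(leF (varT (Fin.last k)) (liftT t) ⟹ ∼φ).all) v ↔ _
      simp⟩
  | succ n => exact ⟨_, hφ.bdex t, fun v => by simp⟩

end PiFormulas

theorem snoc_comp_castSucc {k m : ℕ} (ρ : Fin k → Fin m) (v : Fin m → ℕ) (y : ℕ) :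
    (fun i => (Fin.snoc v y : Fin (m + 1) → ℕ)
      ((Fin.snoc (fun i => (ρ i).castSucc) (Fin.last m) : Fin (k + 1) → Fin (m + 1)) i)) =
    (Fin.snoc (fun i => v (ρ i)) y : Fin (k + 1) → ℕ) := by
  funext i
  refine Fin.lastCases ?_ (fun i => ?_) i <;> simp

/-- The map exchanging the last two variables. -/
def swapLast (k : ℕ) : Fin (k + 1 + 1) → Fin (k + 1 + 1) :=
  Fin.snoc (Fin.snoc (fun i => i.castSucc.castSucc) (Fin.last (k + 1)) : Fin (k + 1) → _)
    (Fin.last k).castSucc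

theorem snoc_swapLast {k : ℕ} (v : Fin k → ℕ) (r x : ℕ) :
    (fun i => (Fin.snoc (Fin.snoc v r : Fin (k + 1) → ℕ) x : Fin (k + 1 + 1) → ℕ)
      (swapLast k i)) = (Fin.snoc (Fin.snoc v x : Fin (k + 1) → ℕ) r : Fin (k + 1 + 1) → ℕ) := by
  funext i
  refine Fin.lastCases ?_ (fun i => Fin.lastCases ?_ (fun i => ?_) i) i <;> simp [swapLast]

/-- Every `Σ_{n+1}`-formula is equivalent in `ℕ` to `∃ p, A` for some `Πₙ`-formula `A`. -/
theorem IsSigma.exists_normalForm {n k : ℕ} {φ : LA.BoundedFormula Empty k}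
    (h : IsSigma (n + 1) φ) : ∃ A : LA.BoundedFormula Empty (k + 1), IsPi n A ∧
      ∀ v : Fin k → ℕ, Sat φ v ↔ ∃ p, Sat A (Fin.snoc v p : Fin (k + 1) → ℕ) := by
  -- replacing a witness by a bound for it
  have bound : ∀ {n k : ℕ} {A : LA.BoundedFormula Empty (k + 1)}, IsPi n A →
      ∃ B : LA.BoundedFormula Empty (k + 1), IsPi n B ∧ ∀ (v : Fin k → ℕ) (r : ℕ),
        Sat B (Fin.snoc v r : Fin (k + 1) → ℕ) ↔
          ∃ p ≤ r, Sat A (Fin.snoc v p : Fin (k + 1) → ℕ) := by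
    intro n k A hA
    obtain ⟨A', hA', eA'⟩ := hA.exists_subst
      (fun i => varT ((Fin.snoc (fun i => i.castSucc.castSucc) (Fin.last (k + 1)) :
        Fin (k + 1) → Fin (k + 1 + 1)) i))
    obtain ⟨B, hB, eB⟩ := hA'.exists_bdex (varT (Fin.last k))
    refine ⟨B, hB, fun v r => ?_⟩
    have := fun p => snoc_comp_castSucc Fin.castSucc (Fin.snoc v r : Fin (k + 1) → ℕ) p
    simp only [Fin.snoc_castSucc] at this
    simp [eB, eA' ℕ, this]
  refine IsSigma.rec (motive_1 := fun N k φ _ => ∀ n, N = n + 1 →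
      ∃ A : LA.BoundedFormula Empty (k + 1), IsPi n A ∧
        ∀ v : Fin k → ℕ, Sat φ v ↔ ∃ p, Sat A (Fin.snoc v p : Fin (k + 1) → ℕ))
    (motive_2 := fun _ _ _ _ => True)
    ?_ ?_ ?_ ?_ ?_ ?_ (fun _ => trivial) (fun _ _ => trivial) (fun _ _ => trivial)
    (fun _ _ _ _ => trivial) (fun _ _ _ _ => trivial) (fun _ _ _ _ => trivial) h n rfl
  · intro k φ _ n h
    omega
  · intro m k φ h _ n hn
    obtain rfl : m = n := by omega
    obtain ⟨A, hA, eA⟩ := h.exists_subst (fun i => varT i.castSucc)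
    exact ⟨A, hA, fun v => by simp [eA ℕ]⟩
  · intro m k φ _ ih n hn
    obtain ⟨A, hA, eA⟩ := ih n hn
    obtain ⟨B, hB, eB⟩ := bound hA
    obtain ⟨B', hB', eB'⟩ := hB.exists_subst
      (fun i => varT (swapLast k i))
    obtain ⟨C, hC, eC⟩ := hB'.exists_bdex (varT (Fin.last k))
    refine ⟨C, hC, fun v => ?_⟩
    simp only [sat_ex, eA, eC, eB' ℕ, evalT_varT, snoc_swapLast, eB, Fin.snoc_last]
    constructor
    · rintro ⟨x, p, hp⟩
      exact ⟨max x p, x, le_max_left _ _, p, le_max_right _ _, hp⟩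
    · rintro ⟨_, x, _, p, _, hp⟩
      exact ⟨x, p, hp⟩
  · intro m k φ ψ _ _ ih₁ ih₂ n hn
    obtain ⟨A₁, h₁, e₁⟩ := ih₁ n hn
    obtain ⟨A₂, h₂, e₂⟩ := ih₂ n hn
    obtain ⟨B₁, h₁, f₁⟩ := bound h₁
    obtain ⟨B₂, h₂, f₂⟩ := bound h₂
    obtain ⟨C, hC, eC⟩ := h₁.exists_inf h₂
    refine ⟨C, hC, fun v => ?_⟩
    simp only [sat_inf, e₁, e₂, eC, f₁, f₂]
    constructor
    · rintro ⟨⟨p, hp⟩, q, hq⟩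
      exact ⟨max p q, ⟨p, le_max_left _ _, hp⟩, q, le_max_right _ _, hq⟩
    · rintro ⟨_, ⟨p, _, hp⟩, q, _, hq⟩
      exact ⟨⟨p, hp⟩, q, hq⟩
  · intro m k φ ψ _ _ ih₁ ih₂ n hn
    obtain ⟨A₁, h₁, e₁⟩ := ih₁ n hn
    obtain ⟨A₂, h₂, e₂⟩ := ih₂ n hn
    obtain ⟨C, hC, eC⟩ := h₁.exists_sup h₂
    exact ⟨C, hC, fun v => by simp only [sat_sup, e₁, e₂, eC, exists_or]⟩
  · intro m k t φ _ ih n hn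
    obtain ⟨A, hA, eA⟩ := ih n hn
    obtain ⟨B, hB, eB⟩ := bound hA
    obtain ⟨B', hB', eB'⟩ := hB.exists_subst
      (fun i => varT (swapLast k i))
    obtain ⟨C, hC, eC⟩ := hB'.exists_bdall (liftT t)
    refine ⟨C, hC, fun v => ?_⟩
    simp only [sat_all, sat_imp, sat_leF, Function.comp_apply, evalT_var, Fin.snoc_last,
      evalT_liftT, leM_nat, eA, eC, eB' ℕ, evalT_varT, snoc_swapLast, eB]
    constructor
    · intro H
      choose! f hf using H
      exact ⟨(Finset.range (evalT t v + 1)).sup f, fun x hx =>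
        ⟨f x, Finset.le_sup (Finset.mem_range.2 (by omega)), hf x hx⟩⟩
    · rintro ⟨r, hr⟩ x hx
      obtain ⟨p, _, hp⟩ := hr x hx
      exact ⟨p, hp⟩

/-! ### `Σ_{n+1}`-definable predicates and functions -/

/-- A predicate of `k` variables is definable in `ℕ` by a `Σ_{n+1}`-formula. -/
def SgK (n k : ℕ) (P : (Fin k → ℕ) → Prop) : Prop :=
  ∃ φ : LA.BoundedFormula Empty k, IsSigma (n + 1) φ ∧ ∀ v : Fin k → ℕ, Sat φ v ↔ P v

section SgK

variable {n k : ℕ} {P Q : (Fin k → ℕ) → Prop}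

theorem SgK.congr (h : SgK n k P) (e : ∀ v, P v ↔ Q v) : SgK n k Q := by
  obtain ⟨φ, h, hφ⟩ := h
  exact ⟨φ, h, fun v => (hφ v).trans (e v)⟩

theorem SgK.and (hP : SgK n k P) (hQ : SgK n k Q) : SgK n k (fun v => P v ∧ Q v) := by
  obtain ⟨φ, h, hφ⟩ := hP
  obtain ⟨ψ, h', hψ⟩ := hQ
  exact ⟨_, h.inf h', fun v => by simp [hφ, hψ]⟩

theorem SgK.or (hP : SgK n k P) (hQ : SgK n k Q) : SgK n k (fun v => P v ∨ Q v) := by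
  obtain ⟨φ, h, hφ⟩ := hP
  obtain ⟨ψ, h', hψ⟩ := hQ
  exact ⟨_, h.sup h', fun v => by simp [hφ, hψ]⟩

theorem SgK.ex {P : (Fin (k + 1) → ℕ) → Prop} (hP : SgK n (k + 1) P) :
    SgK n k (fun v => ∃ x, P (Fin.snoc v x)) := by
  obtain ⟨φ, h, hφ⟩ := hP
  exact ⟨_, h.ex, fun v => by simp [hφ]⟩

theorem SgK.ball {P : (Fin (k + 1) → ℕ) → Prop} (hP : SgK n (k + 1) P) (i : Fin k) :
    SgK n k (fun v => ∀ x ≤ v i, P (Fin.snoc v x)) := by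
  obtain ⟨φ, h, hφ⟩ := hP
  exact ⟨_, h.bdall (varT i), fun v => by simp [hφ]⟩

theorem SgK.reindex (hP : SgK n k P) {m : ℕ} (ρ : Fin k → Fin m) :
    SgK n m (fun v => P (fun i => v (ρ i))) := by
  obtain ⟨φ, h, hφ⟩ := hP
  obtain ⟨φ', h', e⟩ := sigma_pi_exists_subst.1 h (fun i => varT (ρ i))
  exact ⟨φ', h', fun v => by simp [e ℕ, hφ]⟩

theorem SgK.equal (t s : LA.Term (Empty ⊕ Fin k)) : SgK n k (fun v => evalT t v = evalT s v) :=
  ⟨_, ((Delta0.equal t s).isSigma_isPi _).1, fun v => by simp⟩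

theorem SgK.le (t s : LA.Term (Empty ⊕ Fin k)) : SgK n k (fun v => evalT t v ≤ evalT s v) :=
  ⟨_, ((Delta0.le t s).isSigma_isPi _).1, fun v => by simp⟩

end SgK

/-- A set of natural numbers is definable by a `Σ_{n+1}`-formula. -/
def Sg (n : ℕ) (P : ℕ → Prop) : Prop := SgK n 1 (fun v => P (v 0))

/-- The graph of a function is definable by a `Σ_{n+1}`-formula. -/
def Fn (n : ℕ) (f : ℕ → ℕ) : Prop := SgK n 2 (fun v => f (v 0) = v 1)

section Unary

variable {n : ℕ} {P Q : ℕ → Prop} {f g : ℕ → ℕ}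

theorem Sg.and (hP : Sg n P) (hQ : Sg n Q) : Sg n (fun x => P x ∧ Q x) := SgK.and hP hQ

theorem Sg.or (hP : Sg n P) (hQ : Sg n Q) : Sg n (fun x => P x ∨ Q x) := SgK.or hP hQ

theorem Sg.congr (hP : Sg n P) (e : ∀ x, P x ↔ Q x) : Sg n Q := SgK.congr hP fun v => e (v 0)

theorem Sg.comp (hP : Sg n P) (hf : Fn n f) : Sg n (fun x => P (f x)) :=
  ((SgK.and hf (SgK.reindex hP ![1])).ex).congr fun v => by simp [Fin.snoc]

theorem Fn.comp (hf : Fn n f) (hg : Fn n g) : Fn n (fun x => f (g x)) :=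
  ((SgK.and (SgK.reindex hg ![0, 2]) (SgK.reindex hf ![2, 1])).ex).congr fun v => by
    simp [Fin.snoc]

theorem Fn.id : Fn n (fun x => x) := SgK.equal (varT 0) (varT 1)

theorem Fn.const (c : ℕ) : Fn n (fun _ => c) := by
  induction c with
  | zero => exact (SgK.equal zeroT (varT 1)).congr fun v => by simp
  | succ c ih =>
    refine ((SgK.reindex ih ![0, 2]).and (SgK.equal (succT (varT 2)) (varT 1))).ex.congr
      fun v => by simp [Fin.snoc]

theorem SgK.pair_graph : SgK n 3 (fun v => Nat.pair (v 0) (v 1) = v 2) := by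
  refine (((SgK.le (succT (varT 0)) (varT 1)).and
    (SgK.equal (varT 2) (addT (mulT (varT 1) (varT 1)) (varT 0)))).or
    ((SgK.le (varT 1) (varT 0)).and
    (SgK.equal (varT 2) (addT (addT (mulT (varT 0) (varT 0)) (varT 0)) (varT 1))))).congr
    fun v => ?_
  simp only [evalT_succT, evalT_varT, succM_nat, evalT_addT, evalT_mulT, addM_nat, mulM_nat,
    Nat.pair]
  split_ifs with h <;> omega

/-- Binary operations with definable graph act on definable functions. -/
theorem SgK.fn₂ {o : ℕ → ℕ → ℕ} (ho : SgK n 3 (fun v => o (v 0) (v 1) = v 2)) (hf : Fn n f)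
    (hg : Fn n g) : Fn n (fun x => o (f x) (g x)) :=
  ((((hf.reindex ![0, 2]).and (hg.reindex ![0, 3])).and
    (ho.reindex ![2, 3, 1])).ex.ex).congr fun v => by simp [Fin.snoc]

theorem SgK.rel₂ {R : ℕ → ℕ → Prop} (hR : SgK n 2 (fun v => R (v 0) (v 1))) (hf : Fn n f)
    (hg : Fn n g) : Sg n (fun x => R (f x) (g x)) :=
  ((((hf.reindex ![0, 1]).and (hg.reindex ![0, 2])).and
    (hR.reindex ![1, 2])).ex.ex).congr fun v => by simp [Fin.snoc]

theorem Fn.pair (hf : Fn n f) (hg : Fn n g) : Fn n (fun x => Nat.pair (f x) (g x)) :=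
  SgK.pair_graph.fn₂ hf hg

theorem Fn.add (hf : Fn n f) (hg : Fn n g) : Fn n (fun x => f x + g x) :=
  SgK.fn₂ (SgK.equal (addT (varT 0) (varT 1)) (varT 2)) hf hg

theorem Fn.mul (hf : Fn n f) (hg : Fn n g) : Fn n (fun x => f x * g x) :=
  SgK.fn₂ (SgK.equal (mulT (varT 0) (varT 1)) (varT 2)) hf hg

theorem Fn.unpair_fst (hf : Fn n f) : Fn n (fun x => (f x).unpair.1) := by
  refine Fn.comp (f := fun x => x.unpair.1) ?_ hf
  refine (SgK.pair_graph.reindex ![1, 2, 0]).ex.congr fun v => ?_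
  simp only [Fin.snoc]
  constructor
  · rintro ⟨y, hy⟩
    simp at hy
    simp [← hy]
  · intro h
    exact ⟨(v 0).unpair.2, by simp [← h]⟩

theorem Fn.unpair_snd (hf : Fn n f) : Fn n (fun x => (f x).unpair.2) := by
  refine Fn.comp (f := fun x => x.unpair.2) ?_ hf
  refine (SgK.pair_graph.reindex ![2, 1, 0]).ex.congr fun v => ?_
  simp only [Fin.snoc]
  constructor
  · rintro ⟨y, hy⟩
    simp at hy
    simp [← hy]
  · intro h
    exact ⟨(v 0).unpair.1, by simp [← h]⟩

theorem Sg.eq (hf : Fn n f) (hg : Fn n g) : Sg n (fun x => f x = g x) :=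
  SgK.rel₂ (SgK.equal (varT 0) (varT 1)) hf hg

theorem Sg.le (hf : Fn n f) (hg : Fn n g) : Sg n (fun x => f x ≤ g x) :=
  SgK.rel₂ (SgK.le (varT 0) (varT 1)) hf hg

theorem Sg.lt (hf : Fn n f) (hg : Fn n g) : Sg n (fun x => f x < g x) :=
  Sg.le (hf.add (Fn.const 1)) hg

theorem SgK.of_unpair {R : ℕ → ℕ → Prop} (hR : Sg n (fun w => R w.unpair.1 w.unpair.2)) :
    SgK n 2 (fun v => R (v 0) (v 1)) :=
  ((SgK.pair_graph.reindex ![0, 1, 2]).and (SgK.reindex hR ![2])).ex.congr fun v => by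
    simp [Fin.snoc]

theorem Sg.ex {R : ℕ → ℕ → Prop} (hR : Sg n (fun w => R w.unpair.1 w.unpair.2)) :
    Sg n (fun x => ∃ y, R x y) :=
  (SgK.of_unpair hR).ex.congr fun v => by simp [Fin.snoc]

theorem Sg.ball {R : ℕ → ℕ → Prop} (hf : Fn n f)
    (hR : Sg n (fun w => R w.unpair.1 w.unpair.2)) : Sg n (fun x => ∀ y ≤ f x, R x y) :=
  (SgK.and hf (((SgK.of_unpair hR).reindex ![0, 2]).ball 1)).ex.congr fun v => by
    simp [Fin.snoc]

theorem Fn.of_graph (h : Sg n (fun w => f w.unpair.1 = w.unpair.2)) : Fn n f :=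
  SgK.of_unpair (R := fun x y => f x = y) h

theorem Fn.mod_succ (hf : Fn n f) (hg : Fn n g) : Fn n (fun x => f x % (g x + 1)) := by
  refine Fn.of_graph (((Sg.le Fn.id.unpair_snd (hg.comp Fn.id.unpair_fst)).and (Sg.ex
    (R := fun w q => f w.unpair.1 = q * (g w.unpair.1 + 1) + w.unpair.2) ?_)).congr fun w => ?_)
  · exact Sg.eq (hf.comp Fn.id.unpair_fst.unpair_fst)
      ((Fn.id.unpair_snd.mul ((hg.comp Fn.id.unpair_fst.unpair_fst).add (Fn.const 1))).add
        Fn.id.unpair_fst.unpair_snd)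
  · constructor
    · rintro ⟨h, q, hq⟩
      rw [hq, Nat.mul_add_mod', Nat.mod_eq_of_lt (by omega)]
    · intro h
      have h₁ := Nat.mod_lt (f w.unpair.1) (Nat.zero_lt_succ (g w.unpair.1))
      rw [Nat.succ_eq_add_one] at h₁
      refine ⟨by omega, f w.unpair.1 / (g w.unpair.1 + 1), ?_⟩
      rw [← h, mul_comm, Nat.div_add_mod]

theorem Fn.beta (hf : Fn n f) (hg : Fn n g) : Fn n (fun x => Nat.beta (f x) (g x)) :=
  Fn.mod_succ hf.unpair_fst ((hg.add (Fn.const 1)).mul hf.unpair_snd)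

end Unary

/-! ### Inductively generated sets -/

/-- The set generated from `A` by the binary rules `C`. -/
inductive Gen (A : ℕ → Prop) (C : ℕ → ℕ → ℕ → Prop) : ℕ → Prop
  | base {z : ℕ} : A z → Gen A C z
  | step {x y z : ℕ} : Gen A C x → Gen A C y → C x y z → Gen A C z

/-- Derivations witnessing membership in a generated set, with conclusions first. -/
inductive Der (A : ℕ → Prop) (C : ℕ → ℕ → ℕ → Prop) : List ℕ → Prop
  | nil : Der A C []
  | cons {z : ℕ} {L : List ℕ} :
      Der A C L → (A z ∨ ∃ x ∈ L, ∃ y ∈ L, C x y z) → Der A C (z :: L)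

section Generated

variable {A : ℕ → Prop} {C : ℕ → ℕ → ℕ → Prop}

theorem Der.append {L₁ L₂ : List ℕ} (h₁ : Der A C L₁) (h₂ : Der A C L₂) :
    Der A C (L₁ ++ L₂) := by
  induction h₁ with
  | nil => exact h₂
  | cons _ h ih =>
    refine ih.cons (h.imp_right ?_)
    rintro ⟨x, hx, y, hy, h⟩
    exact ⟨x, by simp [hx], y, by simp [hy], h⟩

theorem Gen.exists_der {z : ℕ} (h : Gen A C z) : ∃ L, Der A C (z :: L) := by
  induction h with
  | base h => exact ⟨[], Der.nil.cons (.inl h)⟩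
  | @step x y z _ _ h ih₁ ih₂ =>
    obtain ⟨L₁, h₁⟩ := ih₁
    obtain ⟨L₂, h₂⟩ := ih₂
    exact ⟨_, (h₁.append h₂).cons (.inr ⟨x, by simp, y, by simp, h⟩)⟩

theorem Der.getElem {L : List ℕ} (h : Der A C L) : ∀ (i : ℕ) (hi : i < L.length), A L[i] ∨
    ∃ (j : ℕ) (hj : j < L.length) (k : ℕ) (hk : k < L.length), i < j ∧ i < k ∧
      C L[j] L[k] L[i] := by
  induction h with
  | nil => intro i hi; simp at hi
  | cons _ h ih =>
    rintro (_ | i) hi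
    · refine h.imp (fun h => h) ?_
      rintro ⟨x, hx, y, hy, h⟩
      obtain ⟨j, hj, rfl⟩ := List.getElem_of_mem hx
      obtain ⟨k, hk, rfl⟩ := List.getElem_of_mem hy
      exact ⟨j + 1, by simpa using hj, k + 1, by simpa using hk, by omega, by omega, h⟩
    · refine (ih i (by simpa using hi)).imp (fun h => h) ?_
      rintro ⟨j, hj, k, hk, h₁, h₂, h⟩
      exact ⟨j + 1, by simpa using hj, k + 1, by simpa using hk, by omega, by omega, h⟩

theorem gen_iff_exists_seq (z : ℕ) : Gen A C z ↔ ∃ s l, Nat.beta s 0 = z ∧ ∀ i ≤ l,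
    A (Nat.beta s i) ∨ ∃ j k, (i < j ∧ j ≤ l) ∧ (i < k ∧ k ≤ l) ∧
      C (Nat.beta s j) (Nat.beta s k) (Nat.beta s i) := by
  constructor
  · intro h
    obtain ⟨L, h⟩ := h.exists_der
    have key : ∀ (i : ℕ) (hi : i < (z :: L).length),
        Nat.beta (Nat.unbeta (z :: L)) i = (z :: L)[i] :=
      fun i hi => Nat.beta_unbeta_coe _ ⟨i, hi⟩
    refine ⟨Nat.unbeta (z :: L), L.length, key 0 (by simp), fun i hi => ?_⟩
    have hi' : i < (z :: L).length := by simp; omega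
    rcases h.getElem i hi' with h | ⟨j, hj, k, hk, h₁, h₂, h⟩
    · exact .inl (by rwa [key i hi'])
    · refine .inr ⟨j, k, ⟨h₁, ?_⟩, ⟨h₂, ?_⟩, ?_⟩
      · simpa [Nat.lt_succ_iff] using hj
      · simpa [Nat.lt_succ_iff] using hk
      · rwa [key i hi', key j hj, key k hk]
  · rintro ⟨s, l, rfl, h⟩
    have key : ∀ d i, i ≤ l → l - i = d → Gen A C (Nat.beta s i) := by
      intro d
      induction d using Nat.strong_induction_on with
      | _ d ih =>
        intro i hi hd
        rcases h i hi with h | ⟨j, k, ⟨h₁, h₂⟩, ⟨h₃, h₄⟩, h⟩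
        · exact .base h
        · exact .step (ih (l - j) (by omega) j h₂ rfl) (ih (l - k) (by omega) k h₄ rfl) h
    exact key l 0 (Nat.zero_le _) rfl

theorem Sg.gen {n : ℕ} (hA : Sg n A)
    (hC : Sg n (fun w => C w.unpair.1.unpair.1 w.unpair.1.unpair.2 w.unpair.2)) :
    Sg n (Gen A C) := by
  have hC' : ∀ {f g h : ℕ → ℕ}, Fn n f → Fn n g → Fn n h →
      Sg n (fun x => C (f x) (g x) (h x)) := fun hf hg hh => by
    simpa using hC.comp ((hf.pair hg).pair hh)
  refine Sg.congr ?_ fun z => (gen_iff_exists_seq z).symm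
  refine Sg.ex (Sg.ex (Sg.and ?_ (Sg.ball ?_ (Sg.or (hA.comp ?_) (Sg.ex (Sg.ex (Sg.and (Sg.and
    (Sg.lt ?_ ?_) (Sg.le ?_ ?_)) (Sg.and (Sg.and (Sg.lt ?_ ?_) (Sg.le ?_ ?_))
    (hC' ?_ ?_ ?_)))))))))
  all_goals
    with_reducible repeat' first
      | exact Fn.id
      | exact Fn.const _
      | apply Sg.eq
      | apply Fn.beta
      | apply Fn.unpair_fst
      | apply Fn.unpair_snd

end Generated

/-! ### Codes of lists, terms and formulas -/

/-- The code of a list with head `a` and tail coded by `s`. -/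
def lcons (a s : ℕ) : ℕ := Nat.pair a s + 1

theorem Fn.lcons {n : ℕ} {f g : ℕ → ℕ} (hf : Fn n f) (hg : Fn n g) :
    Fn n (fun x => lcons (f x) (g x)) := (hf.pair hg).add (Fn.const 1)

/-- The code of a list. -/
def enc (l : List ℕ) : ℕ := Encodable.encode l

theorem enc_cons (a : ℕ) (l : List ℕ) : enc (a :: l) = lcons a (enc l) := rfl

theorem enc_inj {l m : List ℕ} : enc l = enc m ↔ l = m := Encodable.encode_inj

theorem enc_surj (c : ℕ) : ∃ l, enc l = c := ⟨Denumerable.ofNat _ c, Denumerable.encode_ofNat c⟩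

theorem encode_eq_enc {α : Type} [Encodable α] (l : List α) :
    Encodable.encode l = enc (l.map Encodable.encode) := by
  induction l with
  | nil => rfl
  | cons a l ih => rw [Encodable.encode_list_cons, ih]; rfl

/-- `d` codes the concatenation of the lists coded by `a` and `b`. -/
def App (a b d : ℕ) : Prop := ∃ l m, enc l = a ∧ enc m = b ∧ enc (l ++ m) = d

theorem app_enc {l m : List ℕ} {d : ℕ} : App (enc l) (enc m) d ↔ d = enc (l ++ m) := by
  constructor
  · rintro ⟨l', m', h₁, h₂, rfl⟩
    rw [enc_inj.1 h₁, enc_inj.1 h₂]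
  · rintro rfl
    exact ⟨l, m, rfl, rfl, rfl⟩

theorem app_iff_gen {a b d : ℕ} : App a b d ↔
    Gen (fun z => ∃ b, z = Nat.pair 0 (Nat.pair b b))
      (fun x _ z => ∃ h a b d, x = Nat.pair a (Nat.pair b d) ∧
        z = Nat.pair (lcons h a) (Nat.pair b (lcons h d))) (Nat.pair a (Nat.pair b d)) := by
  constructor
  · rintro ⟨l, m, rfl, rfl, rfl⟩
    induction l with
    | nil => exact .base ⟨_, rfl⟩
    | cons h l ih => exact .step ih ih ⟨h, _, _, _, rfl, rfl⟩
  · intro h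
    generalize hz : Nat.pair a (Nat.pair b d) = z at h
    induction h generalizing a b d with
    | base h =>
      obtain ⟨c, rfl⟩ := h
      obtain ⟨l, rfl⟩ := enc_surj c
      simp only [Nat.pair_eq_pair] at hz
      obtain ⟨rfl, rfl, rfl⟩ := hz
      exact ⟨[], l, rfl, rfl, rfl⟩
    | step _ _ h ih _ =>
      obtain ⟨h, a', b', d', rfl, rfl⟩ := h
      simp only [Nat.pair_eq_pair] at hz
      obtain ⟨rfl, rfl, rfl⟩ := hz
      obtain ⟨l, m, rfl, rfl, rfl⟩ := ih rfl
      exact ⟨h :: l, m, rfl, rfl, rfl⟩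

theorem Sg.app {n : ℕ} {f g h : ℕ → ℕ} (hf : Fn n f) (hg : Fn n g) (hh : Fn n h) :
    Sg n (fun x => App (f x) (g x) (h x)) := by
  refine ((Sg.gen ?_ ?_).comp (hf.pair (hg.pair hh))).congr fun x => app_iff_gen.symm
  all_goals
    with_reducible repeat' first
      | exact Fn.id
      | exact Fn.const _
      | apply Sg.ex
      | apply Sg.and
      | apply Sg.eq
      | apply Fn.lcons
      | apply Fn.pair
      | apply Fn.unpair_fst
      | apply Fn.unpair_snd

/-- `x` occurs in the list coded by `s`. -/
def Mem (x s : ℕ) : Prop := ∃ l, enc l = s ∧ x ∈ l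

theorem mem_enc {x : ℕ} {l : List ℕ} : Mem x (enc l) ↔ x ∈ l := by
  constructor
  · rintro ⟨m, h, hx⟩
    rwa [← enc_inj.1 h]
  · exact fun h => ⟨l, rfl, h⟩

theorem mem_iff_exists_app {x s : ℕ} : Mem x s ↔ ∃ a b, App a (lcons x b) s := by
  constructor
  · rintro ⟨l, rfl, h⟩
    obtain ⟨l₁, l₂, rfl⟩ := List.append_of_mem h
    exact ⟨_, _, l₁, x :: l₂, rfl, rfl, rfl⟩
  · rintro ⟨_, b, l, m, rfl, h, rfl⟩
    obtain ⟨m', rfl⟩ := enc_surj b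
    rw [← enc_cons, enc_inj] at h
    exact ⟨_, rfl, by simp [h]⟩

theorem Sg.mem {n : ℕ} {f g : ℕ → ℕ} (hf : Fn n f) (hg : Fn n g) :
    Sg n (fun x => Mem (f x) (g x)) := by
  refine Sg.congr (Sg.ex (Sg.ex ?_)) fun _ => mem_iff_exists_app.symm
  exact Sg.app Fn.id.unpair_fst.unpair_snd
    ((hf.comp Fn.id.unpair_fst.unpair_fst).lcons Fn.id.unpair_snd)
    (hg.comp Fn.id.unpair_fst.unpair_fst)

/-! ### Names -/

/-- Names for the elements of a term model. -/
def Name : Type := ℕ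

/-- The operations on names are term formation; `≤` plays no role. -/
instance : LA.Structure Name where
  funMap {_} f := match f with
    | ArithFunc.zero => fun _ => Nat.pair 0 0
    | ArithFunc.succ => fun v => Nat.pair 1 (v 0)
    | ArithFunc.add  => fun v => Nat.pair 2 (Nat.pair (v 0) (v 1))
    | ArithFunc.mul  => fun v => Nat.pair 3 (Nat.pair (v 0) (v 1))
  RelMap {_} _ := fun _ => False

/-- The name of a counterexample to the universal formula with matrix coded by `c`. -/
def nmW (k c e : ℕ) : ℕ := Nat.pair 4 (Nat.pair k (Nat.pair c e))

/-- The name of the numeral of `x`. -/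
def nm : ℕ → ℕ
  | 0 => Nat.pair 0 0
  | x + 1 => Nat.pair 1 (nm x)

theorem nm_graph_iff_gen {x y : ℕ} : nm x = y ↔ Gen (fun z => z = Nat.pair 0 (Nat.pair 0 0))
    (fun u _ z => ∃ a b, u = Nat.pair a b ∧ z = Nat.pair (a + 1) (Nat.pair 1 b))
    (Nat.pair x y) := by
  constructor
  · rintro rfl
    induction x with
    | zero => exact .base rfl
    | succ x ih => exact .step ih ih ⟨_, _, rfl, rfl⟩
  · intro h
    generalize hz : Nat.pair x y = z at h
    induction h generalizing x y with
    | base h =>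
      rw [h, Nat.pair_eq_pair] at hz
      obtain ⟨rfl, rfl⟩ := hz
      rfl
    | step _ _ h ih _ =>
      obtain ⟨a, b, rfl, rfl⟩ := h
      rw [Nat.pair_eq_pair] at hz
      obtain ⟨rfl, rfl⟩ := hz
      rw [nm, ih rfl]

theorem Fn.nm {n : ℕ} {f : ℕ → ℕ} (hf : Fn n f) : Fn n (fun x => nm (f x)) := by
  refine Fn.comp (f := GRNonRE.nm) (Fn.of_graph ?_) hf
  refine ((Sg.gen ?_ ?_).comp (Fn.id.unpair_fst.pair Fn.id.unpair_snd)).congr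
    fun x => nm_graph_iff_gen.symm
  all_goals
    with_reducible repeat' first
      | exact Fn.id
      | exact Fn.const _
      | apply Sg.ex
      | apply Sg.and
      | apply Sg.eq
      | apply Fn.add
      | apply Fn.pair
      | apply Fn.unpair_fst
      | apply Fn.unpair_snd

/-- The assignment coded by `e`. -/
def dec : (k : ℕ) → ℕ → Fin k → ℕ
  | 0, _ => Fin.elim0
  | k + 1, e => Fin.snoc (dec k e.unpair.1) e.unpair.2

@[simp] theorem dec_succ_pair (k e j : ℕ) :
    dec (k + 1) (Nat.pair e j) = (Fin.snoc (dec k e) j : Fin (k + 1) → ℕ) := by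
  simp [dec]

/-- The list of symbols of a term. -/
def tlist {k : ℕ} (t : LA.Term (Empty ⊕ Fin k)) : List ℕ := t.listEncode.map Encodable.encode

/-- The list of symbols of a formula. -/
def flist {k : ℕ} (φ : LA.BoundedFormula Empty k) : List ℕ := φ.listEncode.map Encodable.encode

theorem godel_eq_enc {k : ℕ} (φ : LA.BoundedFormula Empty k) : godel φ = enc (flist φ) :=
  encode_eq_enc _

theorem encode_term {k : ℕ} (t : LA.Term (Empty ⊕ Fin k)) :
    Encodable.encode t = enc (tlist t) := encode_eq_enc _

@[simp] theorem tlist_var {k : ℕ} (i : Fin k) :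
    tlist (Term.var (Sum.inr i) : LA.Term (Empty ⊕ Fin k)) = [4 * i.val + 2] := by
  have h : Encodable.encode i = i.val := rfl
  simp only [tlist, Term.listEncode, List.map_cons, List.map_nil, Encodable.encode_inl,
    Encodable.encode_inr, h, List.cons.injEq, and_true]
  omega

@[simp] theorem tlist_zero {k : ℕ} (ts) :
    tlist (Term.func ArithFunc.zero ts : LA.Term (Empty ⊕ Fin k)) = [1] := by
  simp [tlist, Term.listEncode]
  rfl

@[simp] theorem tlist_succ {k : ℕ} (ts) :
    tlist (Term.func ArithFunc.succ ts : LA.Term (Empty ⊕ Fin k)) = 3 :: tlist (ts 0) := by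
  simp [tlist, Term.listEncode, List.finRange_succ]
  rfl

@[simp] theorem tlist_add {k : ℕ} (ts) :
    tlist (Term.func ArithFunc.add ts : LA.Term (Empty ⊕ Fin k)) =
      5 :: (tlist (ts 0) ++ tlist (ts 1)) := by
  simp [tlist, Term.listEncode, List.finRange_succ]
  rfl

@[simp] theorem tlist_mul {k : ℕ} (ts) :
    tlist (Term.func ArithFunc.mul ts : LA.Term (Empty ⊕ Fin k)) =
      7 :: (tlist (ts 0) ++ tlist (ts 1)) := by
  simp [tlist, Term.listEncode, List.finRange_succ]
  rfl

theorem tlist_liftT {k : ℕ} (t : LA.Term (Empty ⊕ Fin k)) : tlist (liftT t) = tlist t := by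
  induction t with
  | var i =>
    rcases i with i | i
    · exact i.elim
    · exact (tlist_var _).trans (tlist_var _).symm
  | func f ts ih =>
    cases f with
    | zero => exact (tlist_zero _).trans (tlist_zero _).symm
    | succ => exact (tlist_succ _).trans (by rw [tlist_succ, ← ih 0]; rfl)
    | add => exact (tlist_add _).trans (by rw [tlist_add, ← ih 0, ← ih 1]; rfl)
    | mul => exact (tlist_mul _).trans (by rw [tlist_mul, ← ih 0, ← ih 1]; rfl)

theorem flist_falsum {k : ℕ} : flist (⊥ : LA.BoundedFormula Empty k) = [4 * (k + 2) + 3] := by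
  change [_] = _
  simp
  omega

theorem flist_equal {k : ℕ} (t₁ t₂ : LA.Term (Empty ⊕ Fin k)) : flist (t₁ =' t₂) =
    [2 * Nat.pair k (enc (tlist t₁)), 2 * Nat.pair k (enc (tlist t₂))] := by
  change [_, _] = _
  simp [encode_term]

theorem flist_rel {k : ℕ} (ts) :
    flist (BoundedFormula.rel ArithRel.le ts : LA.BoundedFormula Empty k) =
    [1, 4 * k + 3, 2 * Nat.pair k (enc (tlist (ts 0))), 2 * Nat.pair k (enc (tlist (ts 1)))] := by
  simp [flist, listEncode, encode_term, List.finRange_succ]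
  refine ⟨rfl, by omega⟩

theorem flist_imp {k : ℕ} (φ ψ : LA.BoundedFormula Empty k) :
    flist (φ ⟹ ψ) = 3 :: (flist φ ++ flist ψ) := by
  simp [flist, listEncode]

theorem flist_all {k : ℕ} (φ : LA.BoundedFormula Empty (k + 1)) :
    flist φ.all = 7 :: flist φ := by
  simp [flist, listEncode]

theorem flist_injective {k : ℕ} : Function.Injective (flist (k := k)) := by
  intro φ ψ h
  have := listEncode_sigma_injective (a₁ := (⟨k, φ⟩ : Σ k, LA.BoundedFormula Empty k))
    (a₂ := ⟨k, ψ⟩) (List.map_injective_iff.2 Encodable.encode_injective h)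
  exact eq_of_heq (Sigma.mk.inj this).2

/-- The value of a term in the algebra of names. -/
def nval {k : ℕ} (t : LA.Term (Empty ⊕ Fin k)) (d : Fin k → ℕ) : ℕ := evalT (M := Name) t d

theorem nval_var {k : ℕ} (i : Fin k) (d : Fin k → ℕ) :
    nval (Term.var (Sum.inr i)) d = d i := rfl

theorem nval_func_zero {k : ℕ} (ts) (d : Fin k → ℕ) :
    nval (Term.func ArithFunc.zero ts) d = Nat.pair 0 0 := rfl

theorem nval_func_succ {k : ℕ} (ts) (d : Fin k → ℕ) :
    nval (Term.func ArithFunc.succ ts) d = Nat.pair 1 (nval (ts 0) d) := rfl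

theorem nval_func_add {k : ℕ} (ts) (d : Fin k → ℕ) : nval (Term.func ArithFunc.add ts) d =
    Nat.pair 2 (Nat.pair (nval (ts 0) d) (nval (ts 1) d)) := rfl

theorem nval_func_mul {k : ℕ} (ts) (d : Fin k → ℕ) : nval (Term.func ArithFunc.mul ts) d =
    Nat.pair 3 (Nat.pair (nval (ts 0) d) (nval (ts 1) d)) := rfl

theorem nval_liftT {k : ℕ} (t : LA.Term (Empty ⊕ Fin k)) (d : Fin k → ℕ) (j : ℕ) :
    nval (liftT t) (Fin.snoc d j : Fin (k + 1) → ℕ) = nval t d := evalT_liftT (M := Name) _ _ _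

/-- `c` codes a term in `k` variables whose value under the assignment coded by `e` is the
name `v`. -/
def TV (k c e v : ℕ) : Prop := ∃ t : LA.Term (Empty ⊕ Fin k), enc (tlist t) = c ∧
  nval t (dec k e) = v

/-- The axioms generating `TV`. -/
def TVBase (z : ℕ) : Prop :=
  (∃ k e j, z = Nat.pair (k + 1) (Nat.pair (lcons (4 * k + 2) 0)
    (Nat.pair (Nat.pair e j) j))) ∨
  ∃ k e, z = Nat.pair k (Nat.pair (lcons 1 0) (Nat.pair e (Nat.pair 0 0)))

/-- The rules generating `TV`. -/
def TVStep (x y z : ℕ) : Prop := ∃ k c e v c' v', x = Nat.pair k (Nat.pair c (Nat.pair e v)) ∧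
  y = Nat.pair k (Nat.pair c' (Nat.pair e v')) ∧
  ((∃ j, z = Nat.pair (k + 1) (Nat.pair c (Nat.pair (Nat.pair e j) v))) ∨
    z = Nat.pair k (Nat.pair (lcons 3 c) (Nat.pair e (Nat.pair 1 v))) ∨
    ∃ d, App c c' d ∧
      (z = Nat.pair k (Nat.pair (lcons 5 d) (Nat.pair e (Nat.pair 2 (Nat.pair v v')))) ∨
       z = Nat.pair k (Nat.pair (lcons 7 d) (Nat.pair e (Nat.pair 3 (Nat.pair v v'))))))

theorem TV.gen {k : ℕ} (t : LA.Term (Empty ⊕ Fin k)) (e : ℕ) : Gen TVBase TVStep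
    (Nat.pair k (Nat.pair (enc (tlist t)) (Nat.pair e (nval t (dec k e))))) := by
  induction t with
  | var i =>
    rcases i with i | i
    · exact i.elim
    rw [tlist_var, nval_var]
    induction k generalizing e with
    | zero => exact i.elim0
    | succ k ih =>
      rw [← Nat.pair_unpair e, dec_succ_pair]
      refine Fin.lastCases ?_ (fun i => ?_) i
      · rw [Fin.snoc_last]
        exact .base (.inl ⟨k, _, _, rfl⟩)
      · rw [Fin.snoc_castSucc]
        exact .step (ih _ i) (ih _ i) ⟨_, _, _, _, _, _, rfl, rfl, .inl ⟨_, rfl⟩⟩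
  | func f ts ih =>
    cases f with
    | zero =>
      rw [tlist_zero, nval_func_zero]
      exact .base (.inr ⟨_, _, rfl⟩)
    | succ =>
      rw [tlist_succ, nval_func_succ]
      exact .step (ih 0) (ih 0) ⟨_, _, _, _, _, _, rfl, rfl, .inr (.inl rfl)⟩
    | add =>
      rw [tlist_add, nval_func_add]
      exact .step (ih 0) (ih 1) ⟨_, _, _, _, _, _, rfl, rfl, .inr (.inr
        ⟨_, app_enc.2 rfl, .inl rfl⟩)⟩
    | mul =>
      rw [tlist_mul, nval_func_mul]
      exact .step (ih 0) (ih 1) ⟨_, _, _, _, _, _, rfl, rfl, .inr (.inr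
        ⟨_, app_enc.2 rfl, .inr rfl⟩)⟩

theorem tv_iff_gen {k c e v : ℕ} : TV k c e v ↔
    Gen TVBase TVStep (Nat.pair k (Nat.pair c (Nat.pair e v))) := by
  constructor
  · rintro ⟨t, rfl, rfl⟩
    exact TV.gen t e
  · intro h
    generalize hz : Nat.pair k (Nat.pair c (Nat.pair e v)) = z at h
    induction h generalizing k c e v with
    | base h =>
      rcases h with ⟨k, e, j, rfl⟩ | ⟨k, e, rfl⟩ <;> simp only [Nat.pair_eq_pair] at hz <;>
        obtain ⟨rfl, rfl, rfl, rfl⟩ := hz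
      · refine ⟨Term.var (Sum.inr (Fin.last k)), by rw [tlist_var]; rfl, ?_⟩
        rw [nval_var, dec_succ_pair, Fin.snoc_last]
      · exact ⟨zeroT, congrArg enc (tlist_zero _), nval_func_zero _ _⟩
    | step _ _ h ih₁ ih₂ =>
      obtain ⟨k₀, c₀, e₀, v₀, c', v', rfl, rfl, h⟩ := h
      obtain ⟨t, rfl, rfl⟩ := ih₁ rfl
      obtain ⟨t', rfl, rfl⟩ := ih₂ rfl
      rcases h with ⟨j, rfl⟩ | rfl | ⟨d, hd, rfl | rfl⟩ <;> simp only [Nat.pair_eq_pair] at hz <;>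
        obtain ⟨rfl, rfl, rfl, rfl⟩ := hz
      · exact ⟨liftT t, by rw [tlist_liftT], by rw [dec_succ_pair]; exact nval_liftT _ _ _⟩
      · exact ⟨succT t, congrArg enc (tlist_succ _), nval_func_succ _ _⟩
      · rw [app_enc.1 hd]
        exact ⟨addT t t', congrArg enc (tlist_add _), nval_func_add _ _⟩
      · rw [app_enc.1 hd]
        exact ⟨mulT t t', congrArg enc (tlist_mul _), nval_func_mul _ _⟩

theorem Sg.tv {n : ℕ} {f₁ f₂ f₃ f₄ : ℕ → ℕ} (h₁ : Fn n f₁) (h₂ : Fn n f₂) (h₃ : Fn n f₃)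
    (h₄ : Fn n f₄) : Sg n (fun x => TV (f₁ x) (f₂ x) (f₃ x) (f₄ x)) := by
  refine ((Sg.gen ?_ ?_).comp (h₁.pair (h₂.pair (h₃.pair h₄)))).congr fun x => tv_iff_gen.symm
  · unfold TVBase
    with_reducible repeat' first
      | exact Fn.id
      | exact Fn.const _
      | apply Sg.ex
      | apply Sg.or
      | apply Sg.eq
      | apply Fn.lcons
      | apply Fn.add
      | apply Fn.mul
      | apply Fn.pair
      | apply Fn.unpair_fst
      | apply Fn.unpair_snd
  · unfold TVStep
    with_reducible repeat' first
      | exact Fn.id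
      | exact Fn.const _
      | apply Sg.ex
      | apply Sg.and
      | apply Sg.or
      | apply Sg.app
      | apply Sg.eq
      | apply Fn.lcons
      | apply Fn.add
      | apply Fn.pair
      | apply Fn.unpair_fst
      | apply Fn.unpair_snd

/-- `c` codes a formula in `k` variables. -/
def IsForm (k c : ℕ) : Prop := ∃ φ : LA.BoundedFormula Empty k, godel φ = c

/-- The code of the equation between the terms coded by `a` and `b`. -/
def eqCode (k a b : ℕ) : ℕ := lcons (2 * Nat.pair k a) (lcons (2 * Nat.pair k b) 0)

/-- The code of the inequality between the terms coded by `a` and `b`. -/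
def leCode (k a b : ℕ) : ℕ := lcons 1 (lcons (4 * k + 3) (eqCode k a b))

/-- The code of `⊥` in `k` variables. -/
def botCode (k : ℕ) : ℕ := lcons (4 * (k + 2) + 3) 0

theorem godel_falsum {k : ℕ} : godel (⊥ : LA.BoundedFormula Empty k) = botCode k := by
  rw [godel_eq_enc, flist_falsum]; rfl

theorem godel_equal {k : ℕ} (t₁ t₂ : LA.Term (Empty ⊕ Fin k)) :
    godel (t₁ =' t₂) = eqCode k (enc (tlist t₁)) (enc (tlist t₂)) := by
  rw [godel_eq_enc, flist_equal]; rfl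

theorem godel_rel {k : ℕ} (ts) : godel (BoundedFormula.rel ArithRel.le ts :
    LA.BoundedFormula Empty k) = leCode k (enc (tlist (ts 0))) (enc (tlist (ts 1))) := by
  rw [godel_eq_enc, flist_rel]; rfl

theorem godel_all {k : ℕ} (φ : LA.BoundedFormula Empty (k + 1)) :
    godel φ.all = lcons 7 (godel φ) := by
  rw [godel_eq_enc, flist_all, godel_eq_enc]; rfl

theorem app_godel_iff {k : ℕ} (φ ψ : LA.BoundedFormula Empty k) {d : ℕ} :
    App (godel φ) (godel ψ) d ↔ godel (φ ⟹ ψ) = lcons 3 d := by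
  rw [godel_eq_enc, godel_eq_enc, app_enc, godel_eq_enc, flist_imp]
  simp [lcons, enc_cons, eq_comm]

theorem godel_injective {k : ℕ} : Function.Injective (godel (k := k)) := fun φ ψ h => by
  rw [godel_eq_enc, godel_eq_enc, enc_inj] at h
  exact flist_injective h

theorem Fn.eqCode {n : ℕ} {f g h : ℕ → ℕ} (hf : Fn n f) (hg : Fn n g) (hh : Fn n h) :
    Fn n (fun x => eqCode (f x) (g x) (h x)) :=
  ((Fn.const 2).mul (hf.pair hg)).lcons (((Fn.const 2).mul (hf.pair hh)).lcons (Fn.const 0))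

theorem Fn.leCode {n : ℕ} {f g h : ℕ → ℕ} (hf : Fn n f) (hg : Fn n g) (hh : Fn n h) :
    Fn n (fun x => leCode (f x) (g x) (h x)) :=
  (Fn.const 1).lcons ((((Fn.const 4).mul hf).add (Fn.const 3)).lcons (hf.eqCode hg hh))

theorem Fn.botCode {n : ℕ} {f : ℕ → ℕ} (hf : Fn n f) : Fn n (fun x => botCode (f x)) :=
  (((Fn.const 4).mul (hf.add (Fn.const 2))).add (Fn.const 3)).lcons (Fn.const 0)

/-- The axioms generating `IsForm`. -/
def FormBase (z : ℕ) : Prop :=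
  (∃ k, z = Nat.pair k (botCode k)) ∨
  ∃ k a b v w, TV k a 0 v ∧ TV k b 0 w ∧
    (z = Nat.pair k (eqCode k a b) ∨ z = Nat.pair k (leCode k a b))

/-- The rules generating `IsForm`. -/
def FormStep (x y z : ℕ) : Prop :=
  (∃ k c c' d, x = Nat.pair k c ∧ y = Nat.pair k c' ∧ App c c' d ∧ z = Nat.pair k (lcons 3 d)) ∨
  ∃ k c, x = Nat.pair (k + 1) c ∧ z = Nat.pair k (lcons 7 c)

theorem isForm_iff_gen {k c : ℕ} : IsForm k c ↔ Gen FormBase FormStep (Nat.pair k c) := by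
  constructor
  · rintro ⟨φ, rfl⟩
    induction φ with
    | falsum => exact .base (.inl ⟨_, congrArg _ godel_falsum⟩)
    | equal t₁ t₂ =>
      exact .base (.inr ⟨_, _, _, _, _, ⟨t₁, rfl, rfl⟩, ⟨t₂, rfl, rfl⟩,
        .inl (congrArg _ (godel_equal t₁ t₂))⟩)
    | rel R ts =>
      cases R
      exact .base (.inr ⟨_, _, _, _, _, ⟨ts 0, rfl, rfl⟩, ⟨ts 1, rfl, rfl⟩,
        .inr (congrArg _ (godel_rel ts))⟩)
    | imp φ ψ ih₁ ih₂ =>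
      obtain ⟨d, hd⟩ : ∃ d, App (godel φ) (godel ψ) d := by
        rw [godel_eq_enc, godel_eq_enc]
        exact ⟨_, app_enc.2 rfl⟩
      exact .step ih₁ ih₂ (.inl ⟨_, _, _, d, rfl, rfl, hd, congrArg _ ((app_godel_iff _ _).1 hd)⟩)
    | all φ ih => exact .step ih ih (.inr ⟨_, _, rfl, congrArg _ (godel_all φ)⟩)
  · intro h
    generalize hz : Nat.pair k c = z at h
    induction h generalizing k c with
    | base h =>
      rcases h with ⟨k, rfl⟩ | ⟨k, a, b, v, w, ⟨t₁, rfl, _⟩, ⟨t₂, rfl, _⟩, rfl | rfl⟩ <;>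
        rw [Nat.pair_eq_pair] at hz <;> obtain ⟨rfl, rfl⟩ := hz
      · exact ⟨⊥, godel_falsum⟩
      · exact ⟨_, godel_equal t₁ t₂⟩
      · exact ⟨leF t₁ t₂, godel_rel _⟩
    | step _ _ h ih₁ ih₂ =>
      rcases h with ⟨k, c, c', d, rfl, rfl, hd, rfl⟩ | ⟨k, c, rfl, rfl⟩ <;>
        rw [Nat.pair_eq_pair] at hz <;> obtain ⟨rfl, rfl⟩ := hz
      · obtain ⟨φ, rfl⟩ := ih₁ rfl
        obtain ⟨ψ, rfl⟩ := ih₂ rfl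
        exact ⟨_, (app_godel_iff φ ψ).1 hd⟩
      · obtain ⟨φ, rfl⟩ := ih₁ rfl
        exact ⟨_, godel_all φ⟩

theorem Sg.isForm {n : ℕ} {f g : ℕ → ℕ} (hf : Fn n f) (hg : Fn n g) :
    Sg n (fun x => IsForm (f x) (g x)) := by
  refine ((Sg.gen ?_ ?_).comp (hf.pair hg)).congr fun x => isForm_iff_gen.symm
  · unfold FormBase
    with_reducible repeat' first
      | exact Fn.id
      | exact Fn.const _
      | apply Sg.ex
      | apply Sg.and
      | apply Sg.or
      | apply Sg.tv
      | apply Sg.eq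
      | apply Fn.eqCode
      | apply Fn.leCode
      | apply Fn.botCode
      | apply Fn.pair
      | apply Fn.unpair_fst
      | apply Fn.unpair_snd
  · unfold FormStep
    with_reducible repeat' first
      | exact Fn.id
      | exact Fn.const _
      | apply Sg.ex
      | apply Sg.and
      | apply Sg.or
      | apply Sg.app
      | apply Sg.eq
      | apply Fn.lcons
      | apply Fn.add
      | apply Fn.pair
      | apply Fn.unpair_fst
      | apply Fn.unpair_snd

/-! ### A refutation calculus -/

/-- The propositional variable stating that the formula coded by `c` in `k` variables holds under
the assignment of names coded by `e`. -/
def fx (k c e : ℕ) : ℕ := Nat.pair 0 (Nat.pair k (Nat.pair c e))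

/-- The propositional variable stating that two names denote the same element. -/
def eqx (i j : ℕ) : ℕ := Nat.pair 1 (Nat.pair i j)

/-- The propositional variable stating that the elements denoted by two names are related. -/
def lex (i j : ℕ) : ℕ := Nat.pair 2 (Nat.pair i j)

/-- The positive literal. -/
def pos (x : ℕ) : ℕ := Nat.pair x 1

/-- The negative literal. -/
def neg (x : ℕ) : ℕ := Nat.pair x 0

/-- Incompatible literals concerning logical constants and the axioms coded by `Ax`. -/
def BadForm (Ax : ℕ → Prop) (p q r : ℕ) : Prop :=
  (∃ x, p = neg x ∧ q = pos x) ∨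
  (∃ c e, Ax c ∧ p = neg (fx 0 c e)) ∨
  (∃ k e, p = pos (fx k (botCode k) e)) ∨
  (∃ k c c' d e, IsForm k c ∧ IsForm k c' ∧ App c c' d ∧
    ((p = pos (fx k (lcons 3 d) e) ∧ q = pos (fx k c e) ∧ r = neg (fx k c' e)) ∨
     (p = neg (fx k (lcons 3 d) e) ∧ q = neg (fx k c e)) ∨
     (p = neg (fx k (lcons 3 d) e) ∧ q = pos (fx k c' e)))) ∨
  ∃ k c e, IsForm (k + 1) c ∧
    ((∃ j, p = pos (fx k (lcons 7 c) e) ∧ q = neg (fx (k + 1) c (Nat.pair e j))) ∨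
     (p = neg (fx k (lcons 7 c) e) ∧ q = pos (fx (k + 1) c (Nat.pair e (nmW k c e)))))

/-- Incompatible literals concerning atomic formulas. -/
def BadAtom (p q : ℕ) : Prop :=
  ∃ k a b e v w, TV k a e v ∧ TV k b e w ∧
    ((p = pos (fx k (eqCode k a b) e) ∧ q = neg (eqx v w)) ∨
     (p = neg (fx k (eqCode k a b) e) ∧ q = pos (eqx v w)) ∨
     (p = pos (fx k (leCode k a b) e) ∧ q = neg (lex v w)) ∨
     (p = neg (fx k (leCode k a b) e) ∧ q = pos (lex v w)))

/-- Incompatible literals concerning equality. -/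
def BadEq (p q r : ℕ) : Prop :=
  (∃ i, p = neg (eqx i i)) ∨
  ∃ i j, p = pos (eqx i j) ∧
    (q = neg (eqx j i) ∨
     (∃ k, q = pos (eqx j k) ∧ r = neg (eqx i k)) ∨
     q = neg (eqx (Nat.pair 1 i) (Nat.pair 1 j)) ∨
     (∃ i' j', q = pos (eqx i' j') ∧
       (r = neg (eqx (Nat.pair 2 (Nat.pair i i')) (Nat.pair 2 (Nat.pair j j'))) ∨
        r = neg (eqx (Nat.pair 3 (Nat.pair i i')) (Nat.pair 3 (Nat.pair j j'))))) ∨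
     (∃ k, q = pos (lex i k) ∧ r = neg (lex j k)) ∨
     (∃ k, q = pos (lex k i) ∧ r = neg (lex k j)))

/-- Incompatible triples of literals. -/
def Bad (Ax : ℕ → Prop) (p q r : ℕ) : Prop := BadForm Ax p q r ∨ BadAtom p q ∨ BadEq p q r

section

variable {n : ℕ} {Ax : ℕ → Prop}

theorem Fn.fx {f g h : ℕ → ℕ} (hf : Fn n f) (hg : Fn n g) (hh : Fn n h) :
    Fn n (fun x => fx (f x) (g x) (h x)) := (Fn.const 0).pair (hf.pair (hg.pair hh))

theorem Fn.eqx {f g : ℕ → ℕ} (hf : Fn n f) (hg : Fn n g) :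
    Fn n (fun x => eqx (f x) (g x)) := (Fn.const 1).pair (hf.pair hg)

theorem Fn.lex {f g : ℕ → ℕ} (hf : Fn n f) (hg : Fn n g) :
    Fn n (fun x => lex (f x) (g x)) := (Fn.const 2).pair (hf.pair hg)

theorem Fn.pos {f : ℕ → ℕ} (hf : Fn n f) : Fn n (fun x => pos (f x)) := hf.pair (Fn.const 1)

theorem Fn.neg {f : ℕ → ℕ} (hf : Fn n f) : Fn n (fun x => neg (f x)) := hf.pair (Fn.const 0)

theorem Fn.nmW {f g h : ℕ → ℕ} (hf : Fn n f) (hg : Fn n g) (hh : Fn n h) :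
    Fn n (fun x => nmW (f x) (g x) (h x)) := (Fn.const 4).pair (hf.pair (hg.pair hh))

theorem Sg.bad (hAx : Sg n Ax) {f g h : ℕ → ℕ} (hf : Fn n f) (hg : Fn n g) (hh : Fn n h) :
    Sg n (fun x => Bad Ax (f x) (g x) (h x)) := by
  suffices H : Sg n (fun w => Bad Ax w.unpair.1.unpair.1 w.unpair.1.unpair.2 w.unpair.2) by
    simpa using H.comp ((hf.pair hg).pair hh)
  unfold Bad BadForm BadAtom BadEq
  with_reducible repeat' first
    | exact Fn.id
    | exact Fn.const _
    | apply Sg.ex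
    | apply Sg.and
    | apply Sg.or
    | apply Sg.app
    | apply Sg.tv
    | apply Sg.isForm
    | apply Sg.eq
    | apply hAx.comp
    | apply Fn.lcons
    | apply Fn.eqCode
    | apply Fn.leCode
    | apply Fn.botCode
    | apply Fn.fx
    | apply Fn.eqx
    | apply Fn.lex
    | apply Fn.pos
    | apply Fn.neg
    | apply Fn.nmW
    | apply Fn.add
    | apply Fn.pair
    | apply Fn.unpair_fst
    | apply Fn.unpair_snd

/-- Codes of refutable lists of literals. -/
def Ref (Ax : ℕ → Prop) : ℕ → Prop :=
  Gen (fun s => ∃ p q r, (Mem p s ∧ Mem q s ∧ Mem r s) ∧ Bad Ax p q r)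
    (fun s₁ s₂ s => ∃ x, s₁ = lcons (neg x) s ∧ s₂ = lcons (pos x) s)

theorem Sg.ref (hAx : Sg n Ax) : Sg n (Ref Ax) := by
  refine Sg.gen ?_ ?_
  all_goals
    with_reducible repeat' first
      | exact Fn.id
      | apply Sg.ex
      | apply Sg.and
      | apply Sg.mem
      | apply Sg.bad hAx
      | apply Sg.eq
      | apply Fn.lcons
      | apply Fn.pos
      | apply Fn.neg
      | apply Fn.unpair_fst
      | apply Fn.unpair_snd

/-- The literal `p` holds under the valuation `V`. -/
def Holds (V : ℕ → Prop) (p : ℕ) : Prop := (∃ x, p = pos x ∧ V x) ∨ ∃ x, p = neg x ∧ ¬ V x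

@[simp] theorem holds_pos {V : ℕ → Prop} {x : ℕ} : Holds V (pos x) ↔ V x := by
  simp [Holds, pos, neg]

@[simp] theorem holds_neg {V : ℕ → Prop} {x : ℕ} : Holds V (neg x) ↔ ¬ V x := by
  simp [Holds, pos, neg]

/-- A valuation compatible with all the constraints. -/
def Good (Ax V : ℕ → Prop) : Prop :=
  ∀ p q r, Bad Ax p q r → ¬ (Holds V p ∧ Holds V q ∧ Holds V r)

theorem Good.not_ref {V : ℕ → Prop} (hV : Good Ax V) {s : ℕ} (h : Ref Ax s) :
    ∃ p, Mem p s ∧ ¬ Holds V p := by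
  induction h with
  | base h =>
    obtain ⟨p, q, r, ⟨hp, hq, hr⟩, h⟩ := h
    by_contra! H
    exact hV p q r h ⟨H p hp, H q hq, H r hr⟩
  | @step _ _ s _ _ h ih₁ ih₂ =>
    obtain ⟨x, rfl, rfl⟩ := h
    obtain ⟨l, rfl⟩ := enc_surj s
    simp only [← enc_cons, mem_enc] at *
    obtain ⟨p, hp, h₁⟩ := ih₁
    obtain ⟨q, hq, h₂⟩ := ih₂
    rcases List.mem_cons.1 hp with rfl | hp
    · rcases List.mem_cons.1 hq with rfl | hq
      · simp_all
      · exact ⟨q, hq, h₂⟩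
    · exact ⟨p, hp, h₁⟩

theorem exists_not_ref_cons {l : List ℕ} (h : ¬ Ref Ax (enc l)) (x : ℕ) :
    ∃ p, (p = neg x ∨ p = pos x) ∧ ¬ Ref Ax (enc (p :: l)) := by
  by_contra! H
  exact h (.step (H _ (.inl rfl)) (H _ (.inr rfl)) ⟨x, rfl, rfl⟩)

theorem exists_good_of_not_ref {p : ℕ} (hp : ∃ x, p = neg x ∨ p = pos x)
    (h : ¬ Ref Ax (enc [p])) : ∃ V, Good Ax V ∧ Holds V p := by
  choose f hf hf' using fun (l : {l // ¬ Ref Ax (enc l)}) x => exists_not_ref_cons l.2 x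
  let L : ℕ → {l // ¬ Ref Ax (enc l)} := fun N =>
    Nat.rec ⟨[p], h⟩ (fun x l => ⟨f l x :: l.1, hf' l x⟩) N
  have hL : ∀ N, (L (N + 1)).1 = f (L N) N :: (L N).1 := fun N => rfl
  have h₀ : p ∈ (L 0).1 := List.mem_singleton.2 rfl
  have mono : ∀ {M N : ℕ}, M ≤ N → ∀ q ∈ (L M).1, q ∈ (L N).1 := by
    intro M N hMN q hq
    induction hMN with
    | refl => exact hq
    | step _ ih => exact (hL _) ▸ List.mem_cons_of_mem _ ih
  have clash : ∀ {N x : ℕ}, neg x ∈ (L N).1 → pos x ∉ (L N).1 := fun {N x} h₁ h₂ =>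
    (L N).2 (.base ⟨_, _, _, ⟨mem_enc.2 h₁, mem_enc.2 h₂, mem_enc.2 h₁⟩, .inl (.inl ⟨x, rfl, rfl⟩)⟩)
  let V : ℕ → Prop := fun x => f (L x) x = pos x
  have key : ∀ q, Holds V q → ∃ N, q ∈ (L N).1 := by
    rintro q (⟨x, rfl, hx⟩ | ⟨x, rfl, hx⟩)
    · exact ⟨x + 1, by rw [hL]; simp [show f (L x) x = pos x from hx]⟩
    · exact ⟨x + 1, by rw [hL]; simp [(hf (L x) x).resolve_right hx]⟩
  refine ⟨V, fun p q r hb ⟨h₁, h₂, h₃⟩ => ?_, ?_⟩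
  · obtain ⟨N₁, h₁⟩ := key p h₁
    obtain ⟨N₂, h₂⟩ := key q h₂
    obtain ⟨N₃, h₃⟩ := key r h₃
    refine (L (max N₁ (max N₂ N₃))).2 (.base ⟨p, q, r, ⟨mem_enc.2 ?_, mem_enc.2 ?_, mem_enc.2 ?_⟩,
      hb⟩)
    · exact mono (by omega) _ h₁
    · exact mono (by omega) _ h₂
    · exact mono (by omega) _ h₃
  · obtain ⟨x, hx | hx⟩ := hp
    · rw [hx, holds_neg]
      intro hv
      have h₁ : neg x ∈ (L (x + 1)).1 := hx ▸ mono (Nat.zero_le (x + 1)) p h₀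
      refine clash (N := x + 1) (x := x) h₁ ?_
      rw [hL]
      simp [show f (L x) x = pos x from hv]
    · rw [hx, holds_pos]
      by_contra hv
      have h₁ : pos x ∈ (L (x + 1)).1 := hx ▸ mono (Nat.zero_le (x + 1)) p h₀
      refine clash (N := x + 1) (x := x) ?_ h₁
      rw [hL]
      simp [(hf (L x) x).resolve_right hv]

end

/-! ### Soundness of the refutation calculus -/

/-- The interpretation of the numerals. -/
def numM (M : Type) [LA.Structure M] : ℕ → M
  | 0 => zeroM M
  | x + 1 => succM (numM M x)

theorem dec_le (k e : ℕ) (i : Fin k) : dec k e i ≤ e := by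
  induction k generalizing e with
  | zero => exact i.elim0
  | succ k ih =>
    refine Fin.lastCases ?_ (fun i => ?_) i
    · simpa [dec] using Nat.unpair_right_le e
    · simpa [dec] using (ih _ i).trans (Nat.unpair_left_le e)

section Soundness

variable {M : Type} [LA.Structure M]

open Classical in
/-- A counterexample to the formula coded by `c`, if there is one. -/
noncomputable def cex (k c : ℕ) (d : Fin k → M) : M :=
  if h : ∃ (y : M) (φ : LA.BoundedFormula Empty (k + 1)), godel φ = c ∧
    ¬ Sat φ (Fin.snoc d y : Fin (k + 1) → M) then h.choose else zeroM M

theorem cex_spec {k : ℕ} {φ : LA.BoundedFormula Empty (k + 1)} {d : Fin k → M}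
    (h : Sat φ (Fin.snoc d (cex k (godel φ) d) : Fin (k + 1) → M)) : Sat φ.all d := by
  by_contra H
  rw [sat_all] at H
  push Not at H
  obtain ⟨y, hy⟩ := H
  have H : ∃ (y : M) (ψ : LA.BoundedFormula Empty (k + 1)), godel ψ = godel φ ∧
    ¬ Sat ψ (Fin.snoc d y : Fin (k + 1) → M) := ⟨y, φ, rfl, hy⟩
  obtain ⟨ψ, e, hψ⟩ := H.choose_spec
  rw [godel_injective e] at hψ
  rw [cex, dif_pos H] at h
  exact hψ h

variable (M) in
/-- The element denoted by a name. -/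
noncomputable def den (x : ℕ) : M :=
  if _h : x.unpair.1 = 0 then zeroM M
  else if x.unpair.1 = 1 then succM (den x.unpair.2)
  else if x.unpair.1 = 2 then addM (den x.unpair.2.unpair.1) (den x.unpair.2.unpair.2)
  else if x.unpair.1 = 3 then mulM (den x.unpair.2.unpair.1) (den x.unpair.2.unpair.2)
  else cex x.unpair.2.unpair.1 x.unpair.2.unpair.2.unpair.1
    (fun i => den (dec x.unpair.2.unpair.1 x.unpair.2.unpair.2.unpair.2 i))
  termination_by x
  decreasing_by
    all_goals
      have h₁ := Nat.add_le_pair x.unpair.1 x.unpair.2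
      rw [Nat.pair_unpair] at h₁
      have h₂ := Nat.unpair_left_le x.unpair.2
      have h₃ := Nat.unpair_right_le x.unpair.2
      have h₄ := Nat.unpair_right_le x.unpair.2.unpair.2
      try have h₅ := dec_le x.unpair.2.unpair.1 x.unpair.2.unpair.2.unpair.2 i
      omega

theorem den_zero : den M (Nat.pair 0 0) = zeroM M := by rw [den]; simp
theorem den_succ (i : ℕ) : den M (Nat.pair 1 i) = succM (den M i) := by rw [den]; simp
theorem den_add (i j : ℕ) :
    den M (Nat.pair 2 (Nat.pair i j)) = addM (den M i) (den M j) := by rw [den]; simp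
theorem den_mul (i j : ℕ) :
    den M (Nat.pair 3 (Nat.pair i j)) = mulM (den M i) (den M j) := by rw [den]; simp
theorem den_nmW (k c e : ℕ) :
    den M (nmW k c e) = cex k c (fun i => den M (dec k e i)) := by
  rw [den, nmW]
  simp only [Nat.unpair_pair]
  rw [Nat.unpair_pair, Nat.unpair_pair]
  simp

theorem den_nm (x : ℕ) : den M (nm x) = numM M x := by
  induction x with
  | zero => exact den_zero
  | succ x ih => rw [nm, den_succ, ih, numM]

theorem evalT_func_zero {k : ℕ} (ts) (v : Fin k → M) :
    evalT (Term.func ArithFunc.zero ts) v = zeroM M := funMap_zero _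

theorem evalT_func_succ {k : ℕ} (ts) (v : Fin k → M) :
    evalT (Term.func ArithFunc.succ ts) v = succM (evalT (ts 0) v) := funMap_succ _

theorem evalT_func_add {k : ℕ} (ts) (v : Fin k → M) :
    evalT (Term.func ArithFunc.add ts) v = addM (evalT (ts 0) v) (evalT (ts 1) v) := funMap_add _

theorem evalT_func_mul {k : ℕ} (ts) (v : Fin k → M) :
    evalT (Term.func ArithFunc.mul ts) v = mulM (evalT (ts 0) v) (evalT (ts 1) v) := funMap_mul _

/-- A map from names which commutes with the operations commutes with the evaluation of terms. -/
theorem evalT_comp_eq {ν : ℕ → M} (h₀ : ν (Nat.pair 0 0) = zeroM M)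
    (h₁ : ∀ i, ν (Nat.pair 1 i) = succM (ν i))
    (h₂ : ∀ i j, ν (Nat.pair 2 (Nat.pair i j)) = addM (ν i) (ν j))
    (h₃ : ∀ i j, ν (Nat.pair 3 (Nat.pair i j)) = mulM (ν i) (ν j))
    {k : ℕ} (t : LA.Term (Empty ⊕ Fin k)) (d : Fin k → ℕ) :
    evalT t (fun i => ν (d i)) = ν (nval t d) := by
  induction t with
  | var i =>
    rcases i with i | i
    · exact i.elim
    · rfl
  | func f ts ih =>
    cases f with
    | zero => rw [nval_func_zero, h₀]; exact evalT_func_zero _ _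
    | succ => rw [nval_func_succ, h₁, ← ih]; exact evalT_func_succ _ _
    | add => rw [nval_func_add, h₂, ← ih, ← ih]; exact evalT_func_add _ _
    | mul => rw [nval_func_mul, h₃, ← ih, ← ih]; exact evalT_func_mul _ _

variable (M) in
/-- The valuation induced by a structure. -/
def val (x : ℕ) : Prop :=
  if x.unpair.1 = 0 then
    ∃ φ : LA.BoundedFormula Empty x.unpair.2.unpair.1, godel φ = x.unpair.2.unpair.2.unpair.1 ∧
      Sat φ (fun i => den M (dec _ x.unpair.2.unpair.2.unpair.2 i))
  else if x.unpair.1 = 1 then den M x.unpair.2.unpair.1 = den M x.unpair.2.unpair.2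
  else leM (den M x.unpair.2.unpair.1) (den M x.unpair.2.unpair.2)

theorem val_fx {k c e : ℕ} : val M (fx k c e) ↔
    ∃ φ : LA.BoundedFormula Empty k, godel φ = c ∧ Sat φ (fun i => den M (dec k e i)) := by
  have h₁ : (fx k c e).unpair.1 = 0 := by simp [fx]
  have h₂ : (fx k c e).unpair.2 = Nat.pair k (Nat.pair c e) := by simp [fx]
  rw [val, if_pos h₁, h₂, Nat.unpair_pair, Nat.unpair_pair]

theorem val_fx_godel {k e : ℕ} (φ : LA.BoundedFormula Empty k) :
    val M (fx k (godel φ) e) ↔ Sat φ (fun i => den M (dec k e i)) := by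
  rw [val_fx]
  constructor
  · rintro ⟨ψ, h, hψ⟩
    rwa [← godel_injective h]
  · exact fun h => ⟨φ, rfl, h⟩

theorem val_eqx {i j : ℕ} : val M (eqx i j) ↔ den M i = den M j := by simp [val, eqx]

theorem val_lex {i j : ℕ} : val M (lex i j) ↔ leM (den M i) (den M j) := by simp [val, lex]

/-- `M` satisfies the sentences in `T`. -/
def SatT (T : LA.Theory) (M : Type) [LA.Structure M] : Prop :=
  ∀ φ ∈ T, Sat (φ : LA.BoundedFormula Empty 0) (default : Fin 0 → M)

theorem good_val {T : LA.Theory} (hT : SatT T M) :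
    Good (fun c => c ∈ axiomCodes T) (val M) := by
  have hev : ∀ {k : ℕ} (t : LA.Term (Empty ⊕ Fin k)) (d : Fin k → ℕ),
      evalT t (fun i => den M (d i)) = den M (nval t d) :=
    evalT_comp_eq den_zero den_succ den_add den_mul
  have hsnoc : ∀ {k : ℕ} (e j : ℕ), (fun i => den M (dec (k + 1) (Nat.pair e j) i)) =
      (Fin.snoc (fun i => den M (dec k e i)) (den M j) : Fin (k + 1) → M) := by
    intro k e j
    rw [dec_succ_pair]
    exact Fin.comp_snoc (den M) _ _
  rintro p q r (h | h | h) ⟨hp, hq, hr⟩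
  · rcases h with ⟨x, rfl, rfl⟩ | ⟨c, e, ⟨φ, hφ, rfl⟩, rfl⟩ | ⟨k, e, rfl⟩ |
      ⟨k, c, c', d, e, ⟨φ, rfl⟩, ⟨ψ, rfl⟩, hd, h⟩ | ⟨k, c, e, ⟨φ, rfl⟩, h⟩
    · simp_all
    · rw [holds_neg, val_fx_godel] at hp
      rw [Subsingleton.elim (fun i => den M (dec 0 e i)) default] at hp
      exact hp (hT φ hφ)
    · rw [← godel_falsum, holds_pos, val_fx_godel] at hp
      exact hp
    · rw [app_godel_iff] at hd
      simp only [← hd] at h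
      rcases h with ⟨rfl, rfl, rfl⟩ | ⟨rfl, rfl⟩ | ⟨rfl, rfl⟩ <;>
      simp only [holds_pos, holds_neg, val_fx_godel, sat_imp] at hp hq hr <;> tauto
    · rw [← godel_all] at h
      rcases h with ⟨j, rfl, rfl⟩ | ⟨rfl, rfl⟩ <;>
      simp only [holds_pos, holds_neg, val_fx_godel, hsnoc] at hp hq
      · exact hq (hp _)
      · rw [den_nmW] at hq
        exact hp (cex_spec hq)
  · obtain ⟨k, a, b, e, v, w, ⟨t, rfl, rfl⟩, ⟨s, rfl, rfl⟩, h⟩ := h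
    rw [← godel_equal, show leCode k (enc (tlist t)) (enc (tlist s)) = godel (leF t s) from
      (godel_rel ![t, s]).symm] at h
    rcases h with ⟨rfl, rfl⟩ | ⟨rfl, rfl⟩ | ⟨rfl, rfl⟩ | ⟨rfl, rfl⟩ <;>
    simp only [holds_pos, holds_neg, val_fx_godel, val_eqx, val_lex, sat_equal, sat_leF,
      hev] at hp hq <;> tauto
  · rcases h with ⟨i, rfl⟩ | ⟨i, j, rfl, rfl | ⟨k, rfl, rfl⟩ | rfl | ⟨i', j', rfl, rfl | rfl⟩ |
      ⟨k, rfl, rfl⟩ | ⟨k, rfl, rfl⟩⟩ <;>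
    simp only [holds_pos, holds_neg, val_eqx, val_lex, den_succ, den_add, den_mul] at hp hq hr <;>
    simp_all

end Soundness

/-! ### Completeness of the refutation calculus -/

section Completeness

variable {Ax V : ℕ → Prop}

namespace Good

theorem of_bad_pair (hV : Good Ax V) {p q : ℕ} (h : Bad Ax p q p) (hp : Holds V p) :
    ¬ Holds V q := fun hq => hV p q p h ⟨hp, hq, hp⟩

theorem ax (hV : Good Ax V) {c : ℕ} (hc : Ax c) (e : ℕ) : V (fx 0 c e) :=
  by_contra fun h => hV (neg (fx 0 c e)) (neg (fx 0 c e)) (neg (fx 0 c e))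
    (.inl (.inr (.inl ⟨c, e, hc, rfl⟩))) (by simp [h])

theorem falsum (hV : Good Ax V) (k e : ℕ) : ¬ V (fx k (botCode k) e) := fun h =>
  hV (pos (fx k (botCode k) e)) (pos (fx k (botCode k) e)) (pos (fx k (botCode k) e))
    (.inl (.inr (.inr (.inl ⟨k, e, rfl⟩)))) (by simp [h])

theorem imp (hV : Good Ax V) {k : ℕ} (φ ψ : LA.BoundedFormula Empty k) (e : ℕ) :
    V (fx k (godel (φ ⟹ ψ)) e) ↔ (V (fx k (godel φ) e) → V (fx k (godel ψ) e)) := by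
  obtain ⟨d, hd⟩ : ∃ d, App (godel φ) (godel ψ) d := by
    rw [godel_eq_enc, godel_eq_enc]
    exact ⟨_, app_enc.2 rfl⟩
  have bad : ∀ p q r, _ → Bad Ax p q r := fun p q r h =>
    .inl (.inr (.inr (.inr (.inl ⟨k, _, _, d, e, ⟨φ, rfl⟩, ⟨ψ, rfl⟩, hd, h⟩))))
  rw [(app_godel_iff φ ψ).1 hd]
  have h₁ := hV _ _ _ (bad _ _ _ (.inl ⟨rfl, rfl, rfl⟩))
  have h₂ := hV _ _ _ (bad _ _ (neg (fx k (lcons 3 d) e)) (.inr (.inl ⟨rfl, rfl⟩)))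
  have h₃ := hV _ _ _ (bad _ _ (neg (fx k (lcons 3 d) e)) (.inr (.inr ⟨rfl, rfl⟩)))
  simp only [holds_pos, holds_neg] at h₁ h₂ h₃
  tauto

theorem all (hV : Good Ax V) {k : ℕ} (φ : LA.BoundedFormula Empty (k + 1)) (e : ℕ) :
    V (fx k (godel φ.all) e) ↔ ∀ j, V (fx (k + 1) (godel φ) (Nat.pair e j)) := by
  have bad : ∀ p q, _ → Bad Ax p q p := fun p q h =>
    .inl (.inr (.inr (.inr (.inr ⟨k, _, e, ⟨φ, rfl⟩, h⟩))))
  rw [godel_all]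
  constructor
  · intro h j
    simpa using hV.of_bad_pair (bad _ _ (.inl ⟨j, rfl, rfl⟩)) (holds_pos.2 h)
  · intro h
    by_contra H
    exact hV.of_bad_pair (bad _ _ (.inr ⟨rfl, rfl⟩)) (holds_neg.2 H) (holds_pos.2 (h _))

theorem equal (hV : Good Ax V) {k : ℕ} (t s : LA.Term (Empty ⊕ Fin k)) (e : ℕ) :
    V (fx k (godel (t =' s)) e) ↔ V (eqx (nval t (dec k e)) (nval s (dec k e))) := by
  have bad : ∀ p q, _ → Bad Ax p q p := fun p q h =>
    .inr (.inl ⟨k, _, _, e, _, _, ⟨t, rfl, rfl⟩, ⟨s, rfl, rfl⟩, h⟩)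
  rw [godel_equal]
  have h₁ := hV.of_bad_pair (bad _ _ (.inl ⟨rfl, rfl⟩))
  have h₂ := hV.of_bad_pair (bad _ _ (.inr (.inl ⟨rfl, rfl⟩)))
  simp only [holds_pos, holds_neg] at h₁ h₂
  tauto

theorem rel (hV : Good Ax V) {k : ℕ} (ts : Fin 2 → LA.Term (Empty ⊕ Fin k)) (e : ℕ) :
    V (fx k (godel (BoundedFormula.rel ArithRel.le ts : LA.BoundedFormula Empty k)) e) ↔
      V (lex (nval (ts 0) (dec k e)) (nval (ts 1) (dec k e))) := by
  have bad : ∀ p q, _ → Bad Ax p q p := fun p q h =>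
    .inr (.inl ⟨k, _, _, e, _, _, ⟨ts 0, rfl, rfl⟩, ⟨ts 1, rfl, rfl⟩, h⟩)
  rw [godel_rel]
  have h₁ := hV.of_bad_pair (bad _ _ (.inr (.inr (.inl ⟨rfl, rfl⟩))))
  have h₂ := hV.of_bad_pair (bad _ _ (.inr (.inr (.inr ⟨rfl, rfl⟩))))
  simp only [holds_pos, holds_neg] at h₁ h₂
  tauto

theorem eqx_refl (hV : Good Ax V) (i : ℕ) : V (eqx i i) :=
  by_contra fun h => hV (neg (eqx i i)) (neg (eqx i i)) (neg (eqx i i))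
    (.inr (.inr (.inl ⟨i, rfl⟩))) (by simp [h])

theorem not_badEq (hV : Good Ax V) {p q r : ℕ} (h : BadEq p q r) :
    ¬ (Holds V p ∧ Holds V q ∧ Holds V r) := hV p q r (.inr (.inr h))

theorem eqx_symm (hV : Good Ax V) {i j : ℕ} (h : V (eqx i j)) : V (eqx j i) := by
  simpa [h] using hV.not_badEq (r := pos (eqx i j)) (.inr ⟨i, j, rfl, .inl rfl⟩)

theorem eqx_trans (hV : Good Ax V) {i j k : ℕ} (h : V (eqx i j)) (h' : V (eqx j k)) :
    V (eqx i k) := by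
  simpa [h, h'] using hV.not_badEq (.inr ⟨i, j, rfl, .inr (.inl ⟨k, rfl, rfl⟩)⟩)

theorem eqx_succ (hV : Good Ax V) {i j : ℕ} (h : V (eqx i j)) :
    V (eqx (Nat.pair 1 i) (Nat.pair 1 j)) := by
  simpa [h] using hV.not_badEq (r := pos (eqx i j)) (.inr ⟨i, j, rfl, .inr (.inr (.inl rfl))⟩)

theorem eqx_add (hV : Good Ax V) {i j i' j' : ℕ} (h : V (eqx i j)) (h' : V (eqx i' j')) :
    V (eqx (Nat.pair 2 (Nat.pair i i')) (Nat.pair 2 (Nat.pair j j'))) := by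
  simpa [h, h'] using hV.not_badEq
    (.inr ⟨i, j, rfl, (.inr (.inr (.inr (.inl ⟨i', j', rfl, .inl rfl⟩))))⟩)

theorem eqx_mul (hV : Good Ax V) {i j i' j' : ℕ} (h : V (eqx i j)) (h' : V (eqx i' j')) :
    V (eqx (Nat.pair 3 (Nat.pair i i')) (Nat.pair 3 (Nat.pair j j'))) := by
  simpa [h, h'] using hV.not_badEq
    (.inr ⟨i, j, rfl, (.inr (.inr (.inr (.inl ⟨i', j', rfl, .inr rfl⟩))))⟩)

theorem lex_left (hV : Good Ax V) {i j k : ℕ} (h : V (eqx i j)) (h' : V (lex i k)) :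
    V (lex j k) := by
  simpa [h, h'] using hV.not_badEq
    (.inr ⟨i, j, rfl, (.inr (.inr (.inr (.inr (.inl ⟨k, rfl, rfl⟩)))))⟩)

theorem lex_right (hV : Good Ax V) {i j k : ℕ} (h : V (eqx i j)) (h' : V (lex k i)) :
    V (lex k j) := by
  simpa [h, h'] using hV.not_badEq
    (.inr ⟨i, j, rfl, (.inr (.inr (.inr (.inr (.inr ⟨k, rfl, rfl⟩)))))⟩)

/-- Names are identified when they denote the same element. -/
def setoid (hV : Good Ax V) : Setoid ℕ :=
  ⟨fun i j => V (eqx i j), hV.eqx_refl, hV.eqx_symm, hV.eqx_trans⟩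

/-- The term model of a valuation. -/
def Model (hV : Good Ax V) : Type := Quotient hV.setoid

/-- The element of the term model denoted by a name. -/
def mk (hV : Good Ax V) (i : ℕ) : hV.Model := Quotient.mk hV.setoid i

theorem mk_eq (hV : Good Ax V) {i j : ℕ} : hV.mk i = hV.mk j ↔ V (eqx i j) :=
  Quotient.eq (r := hV.setoid)

theorem mk_surj (hV : Good Ax V) : Function.Surjective hV.mk := Quotient.mk_surjective

/-- A name of an element of the term model. -/
noncomputable def out (hV : Good Ax V) (x : hV.Model) : ℕ := (hV.mk_surj x).choose

theorem mk_out (hV : Good Ax V) (x : hV.Model) : hV.mk (hV.out x) = x := (hV.mk_surj x).choose_spec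

theorem out_mk (hV : Good Ax V) (i : ℕ) : V (eqx (hV.out (hV.mk i)) i) := hV.mk_eq.1 (hV.mk_out _)

noncomputable instance (hV : Good Ax V) : LA.Structure hV.Model where
  funMap {_} f := match f with
    | ArithFunc.zero => fun _ => hV.mk (Nat.pair 0 0)
    | ArithFunc.succ => fun v => hV.mk (Nat.pair 1 (hV.out (v 0)))
    | ArithFunc.add => fun v => hV.mk (Nat.pair 2 (Nat.pair (hV.out (v 0)) (hV.out (v 1))))
    | ArithFunc.mul => fun v => hV.mk (Nat.pair 3 (Nat.pair (hV.out (v 0)) (hV.out (v 1))))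
  RelMap {_} r := match r with
    | ArithRel.le => fun v => V (lex (hV.out (v 0)) (hV.out (v 1)))

theorem mk_zero (hV : Good Ax V) : hV.mk (Nat.pair 0 0) = zeroM hV.Model := rfl

theorem mk_succ (hV : Good Ax V) (i : ℕ) : hV.mk (Nat.pair 1 i) = succM (hV.mk i) :=
  hV.mk_eq.2 (hV.eqx_succ (hV.eqx_symm (hV.out_mk i)))

theorem mk_add (hV : Good Ax V) (i j : ℕ) :
    hV.mk (Nat.pair 2 (Nat.pair i j)) = addM (hV.mk i) (hV.mk j) :=
  hV.mk_eq.2 (hV.eqx_add (hV.eqx_symm (hV.out_mk i)) (hV.eqx_symm (hV.out_mk j)))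

theorem mk_mul (hV : Good Ax V) (i j : ℕ) :
    hV.mk (Nat.pair 3 (Nat.pair i j)) = mulM (hV.mk i) (hV.mk j) :=
  hV.mk_eq.2 (hV.eqx_mul (hV.eqx_symm (hV.out_mk i)) (hV.eqx_symm (hV.out_mk j)))

theorem leM_mk (hV : Good Ax V) (i j : ℕ) : leM (hV.mk i) (hV.mk j) ↔ V (lex i j) :=
  ⟨fun h => hV.lex_left (hV.out_mk i) (hV.lex_right (hV.out_mk j) h), fun h =>
    hV.lex_left (hV.eqx_symm (hV.out_mk i)) (hV.lex_right (hV.eqx_symm (hV.out_mk j)) h)⟩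

theorem mk_nm (hV : Good Ax V) (x : ℕ) : hV.mk (nm x) = numM hV.Model x := by
  induction x with
  | zero => exact hV.mk_zero
  | succ x ih => rw [nm, mk_succ, ih, numM]

theorem evalT_mk (hV : Good Ax V) {k : ℕ} (t : LA.Term (Empty ⊕ Fin k)) (d : Fin k → ℕ) :
    evalT t (fun i => hV.mk (d i)) = hV.mk (nval t d) :=
  evalT_comp_eq hV.mk_zero hV.mk_succ hV.mk_add hV.mk_mul t d

theorem sat_mk (hV : Good Ax V) {k : ℕ} (φ : LA.BoundedFormula Empty k) (e : ℕ) :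
    Sat φ (fun i => hV.mk (dec k e i)) ↔ V (fx k (godel φ) e) := by
  induction φ generalizing e with
  | @falsum k => exact ⟨False.elim, fun h => hV.falsum k e (godel_falsum ▸ h)⟩
  | equal t s =>
    refine Iff.trans (sat_equal _ t s) (Iff.trans ?_ (hV.equal t s e).symm)
    rw [evalT_mk, evalT_mk, mk_eq]
  | rel R ts =>
    cases R
    refine Iff.trans ?_ (hV.rel ts e).symm
    rw [← hV.leM_mk, ← evalT_mk, ← evalT_mk]
    exact relMap_le _
  | imp φ ψ ih₁ ih₂ => rw [hV.imp, ← ih₁, ← ih₂, sat_imp]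
  | all φ ih =>
    rw [hV.all, sat_all, hV.mk_surj.forall]
    refine forall_congr' fun j => ?_
    rw [← ih, dec_succ_pair]
    refine iff_of_eq (congrArg _ ?_)
    exact (Fin.comp_snoc hV.mk _ _).symm

end Good

theorem Good.satT {T : LA.Theory} (hV : Good (fun c => c ∈ axiomCodes T) V) :
    SatT T hV.Model := fun φ hφ => by
  rw [Subsingleton.elim (default : Fin 0 → hV.Model) (fun i => hV.mk (dec 0 0 i)), hV.sat_mk]
  exact hV.ax ⟨φ, hφ, rfl⟩ 0

theorem Good.sat_mk_nm (hV : Good Ax V) (φ : LA.BoundedFormula Empty 1) (m : ℕ) :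
    Sat φ (fun _ => numM hV.Model m) ↔ V (fx 1 (godel φ) (Nat.pair 0 (nm m))) := by
  rw [← hV.sat_mk, ← hV.mk_nm]
  refine iff_of_eq (congrArg _ (funext fun i => ?_))
  rw [dec_succ_pair, Subsingleton.elim i (Fin.last 0), Fin.snoc_last]

theorem val_fx_nm {M : Type} [LA.Structure M] (φ : LA.BoundedFormula Empty 1) (m : ℕ) :
    val M (fx 1 (godel φ) (Nat.pair 0 (nm m))) ↔ Sat φ (fun _ => numM M m) := by
  rw [val_fx_godel, ← den_nm]
  refine iff_of_eq (congrArg _ (funext fun i => ?_))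
  rw [dec_succ_pair, Subsingleton.elim i (Fin.last 0), Fin.snoc_last]

theorem ref_neg_iff {T : LA.Theory} (φ : LA.BoundedFormula Empty 1) (m : ℕ) :
    Ref (fun c => c ∈ axiomCodes T) (enc [neg (fx 1 (godel φ) (Nat.pair 0 (nm m)))]) ↔
      ∀ (M : Type) [LA.Structure M], SatT T M → Sat φ (fun _ => numM M m) := by
  constructor
  · intro h M _ hM
    obtain ⟨q, hq, hv⟩ := (good_val hM).not_ref h
    rw [mem_enc, List.mem_singleton] at hq
    rwa [hq, holds_neg, not_not, val_fx_nm] at hv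
  · intro h
    by_contra H
    obtain ⟨V, hV, hv⟩ := exists_good_of_not_ref ⟨_, .inl rfl⟩ H
    rw [holds_neg, ← hV.sat_mk_nm] at hv
    exact hv (h _ hV.satT)

theorem ref_pos_iff {T : LA.Theory} (φ : LA.BoundedFormula Empty 1) (m : ℕ) :
    Ref (fun c => c ∈ axiomCodes T) (enc [pos (fx 1 (godel φ) (Nat.pair 0 (nm m)))]) ↔
      ∀ (M : Type) [LA.Structure M], SatT T M → ¬ Sat φ (fun _ => numM M m) := by
  constructor
  · intro h M _ hM
    obtain ⟨q, hq, hv⟩ := (good_val hM).not_ref h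
    rw [mem_enc, List.mem_singleton] at hq
    rwa [hq, holds_pos, val_fx_nm] at hv
  · intro h
    by_contra H
    obtain ⟨V, hV, hv⟩ := exists_good_of_not_ref ⟨_, .inr rfl⟩ H
    rw [holds_pos, ← hV.sat_mk_nm] at hv
    exact h _ hV.satT hv

end Completeness

/-! ### Provability and models -/

theorem proves_iff {T : LA.Theory} {φ : LA.Sentence} : Proves T φ ↔
    ∀ (M : Type) [LA.Structure M], SatT T M →
      Sat (φ : LA.BoundedFormula Empty 0) (default : Fin 0 → M) := by
  constructor
  · intro h M _ hM
    have : M ⊨ T := ⟨fun ψ hψ => hM ψ hψ⟩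
    have : Nonempty M := ⟨zeroM M⟩
    exact h (Theory.ModelType.of T M) default default
  · intro h M v xs
    rw [Subsingleton.elim v default, Subsingleton.elim xs default]
    exact h M fun ψ hψ => Theory.realize_sentence_of_mem T hψ

theorem Consistent.exists_satT {T : LA.Theory} (h : Consistent T) :
    ∃ (M : Type) (_ : LA.Structure M), SatT T M := by
  by_contra! H
  exact h (proves_iff.2 fun M _ hM => (H M _ hM).elim)

/-! ### Models of Robinson arithmetic -/

/-- The axioms of Robinson arithmetic hold in `M`. -/
structure IsRobinson (M : Type) [LA.Structure M] : Prop where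
  succ_ne_zero (x : M) : succM x ≠ zeroM M
  succ_inj (x y : M) : succM x = succM y → x = y
  eq_succ (x : M) : x ≠ zeroM M → ∃ y, x = succM y
  add_zero (x : M) : addM x (zeroM M) = x
  add_succ (x y : M) : addM x (succM y) = succM (addM x y)
  mul_zero (x : M) : mulM x (zeroM M) = zeroM M
  mul_succ (x y : M) : mulM x (succM y) = addM (mulM x y) x
  le_iff (x y : M) : leM x y ↔ ∃ z, addM z x = y

theorem ExtendsQ.isRobinson {T : LA.Theory} (hQ : ExtendsQ T) {M : Type} [LA.Structure M]
    (hM : SatT T M) : IsRobinson M := by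
  have h := fun φ hφ => proves_iff.1 (hQ φ hφ) M hM
  simp only [QTheory, Set.mem_insert_iff, Set.mem_singleton_iff, forall_eq_or_imp,
    forall_eq] at h
  obtain ⟨h₁, h₂, h₃, h₄, h₅, h₆, h₇, h₈⟩ := h
  refine ⟨fun x => ?_, fun x y => ?_, fun x => ?_, fun x => ?_, fun x y => ?_, fun x => ?_,
    fun x y => ?_, fun x y => ?_⟩
  · simpa [Sat, Fin.snoc] using h₁ x
  · simpa [Sat, Fin.snoc] using h₂ x y
  · simpa [Sat, Fin.snoc] using h₃ x
  · simpa [Sat, Fin.snoc] using h₄ x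
  · simpa [Sat, Fin.snoc] using h₅ x y
  · simpa [Sat, Fin.snoc] using h₆ x
  · simpa [Sat, Fin.snoc] using h₇ x y
  · simpa [Sat, Fin.snoc] using h₈ x y

/-- The numerals as terms in `k` variables. -/
def numT {k : ℕ} : ℕ → LA.Term (Empty ⊕ Fin k)
  | 0 => zeroT
  | m + 1 => succT (numT m)

@[simp] theorem evalT_numT {M : Type} [LA.Structure M] {k : ℕ} (m : ℕ) (v : Fin k → M) :
    evalT (numT m) v = numM M m := by
  induction m with
  | zero => simp [numT, numM]
  | succ m ih => simp [numT, numM, ih]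

@[simp] theorem numM_nat (m : ℕ) : numM ℕ m = m := by
  induction m with
  | zero => rfl
  | succ m ih => simp [numM, ih]

namespace IsRobinson

variable {M : Type} [LA.Structure M]

theorem add_num (h : IsRobinson M) (a b : ℕ) :
    addM (numM M a) (numM M b) = numM M (a + b) := by
  induction b with
  | zero => exact h.add_zero _
  | succ b ih => rw [numM, h.add_succ, ih, ← Nat.add_assoc, numM]

theorem mul_num (h : IsRobinson M) (a b : ℕ) :
    mulM (numM M a) (numM M b) = numM M (a * b) := by
  induction b with
  | zero => exact h.mul_zero _
  | succ b ih => rw [numM, h.mul_succ, ih, h.add_num, Nat.mul_succ]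

theorem evalT_num (h : IsRobinson M) {k : ℕ} (t : LA.Term (Empty ⊕ Fin k)) (v : Fin k → ℕ) :
    evalT t (fun i => numM M (v i)) = numM M (evalT t v) := by
  induction t with
  | var i =>
    rcases i with i | i
    · exact i.elim
    · rfl
  | func f ts ih =>
    cases f with
    | zero => exact evalT_func_zero _ _
    | succ => exact (evalT_func_succ _ _).trans (congrArg _ (ih 0))
    | add => exact (evalT_func_add _ _).trans (by rw [ih, ih, h.add_num]; rfl)
    | mul => exact (evalT_func_mul _ _).trans (by rw [ih, ih, h.mul_num]; rfl)

theorem exists_of_le_num (h : IsRobinson M) {x : M} {b : ℕ} (hx : leM x (numM M b)) :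
    ∃ a ≤ b, x = numM M a := by
  induction b generalizing x with
  | zero =>
    by_contra H
    obtain ⟨y, rfl⟩ := h.eq_succ x fun hx => H ⟨0, le_rfl, hx⟩
    obtain ⟨z, hz⟩ := (h.le_iff _ _).1 hx
    rw [h.add_succ] at hz
    exact h.succ_ne_zero _ hz
  | succ b ih =>
    by_cases hx₀ : x = zeroM M
    · exact ⟨0, Nat.zero_le _, hx₀⟩
    obtain ⟨y, rfl⟩ := h.eq_succ x hx₀
    obtain ⟨z, hz⟩ := (h.le_iff _ _).1 hx
    rw [h.add_succ] at hz
    obtain ⟨a, ha, rfl⟩ := ih ((h.le_iff _ _).2 ⟨z, h.succ_inj _ _ hz⟩)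
    exact ⟨a + 1, Nat.succ_le_succ ha, rfl⟩

theorem num_le_num (h : IsRobinson M) {a b : ℕ} (hab : a ≤ b) : leM (numM M a) (numM M b) :=
  (h.le_iff _ _).2 ⟨numM M (b - a), by rw [h.add_num, Nat.sub_add_cancel hab]⟩

theorem le_total_num (h : IsRobinson M) (x : M) (b : ℕ) :
    leM x (numM M b) ∨ leM (numM M b) x := by
  induction b generalizing x with
  | zero => exact .inr ((h.le_iff _ _).2 ⟨x, h.add_zero x⟩)
  | succ b ih =>
    by_cases hx₀ : x = zeroM M
    · exact .inl (hx₀ ▸ h.num_le_num (Nat.zero_le (b + 1)))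
    obtain ⟨y, rfl⟩ := h.eq_succ x hx₀
    simp only [h.le_iff, numM, h.add_succ] at ih ⊢
    exact (ih y).imp (fun ⟨z, hz⟩ => ⟨z, by rw [hz]⟩) (fun ⟨z, hz⟩ => ⟨z, by rw [hz]⟩)

end IsRobinson

/-! ### Transfer of `Πₙ`-formulas between `ℕ` and models -/

/-- The true `Πₙ`-sentences hold in `M`. -/
def PiCorrect (n : ℕ) (M : Type) [LA.Structure M] : Prop :=
  ∀ φ : LA.BoundedFormula Empty 0, IsPi n φ → Sat φ (default : Fin 0 → ℕ) →
    Sat φ (default : Fin 0 → M)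

section Transfer

variable {M : Type} [LA.Structure M]

theorem PiCorrect.sat {n : ℕ} (hM : PiCorrect n M) {k : ℕ} {φ : LA.BoundedFormula Empty k}
    (hφ : IsPi n φ) {v : Fin k → ℕ} (hv : Sat φ v) : Sat φ (fun i => numM M (v i)) := by
  obtain ⟨ψ, hψ, e⟩ := hφ.exists_subst (m := 0) (fun i => numT (v i))
  have := hM ψ hψ ((e ℕ _).2 (by simpa using hv))
  simpa using (e M _).1 this

theorem IsRobinson.not_sat (h : IsRobinson M) {n k : ℕ} {φ : LA.BoundedFormula Empty k}
    (hφ : IsPi n φ) : PiCorrect n M → ∀ v : Fin k → ℕ, ¬ Sat φ v →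
      ¬ Sat φ (fun i => numM M (v i)) := by
  have neg : ∀ {n k : ℕ} {φ φ' : LA.BoundedFormula Empty k}, IsPi n φ' → IsNeg φ φ' →
      PiCorrect n M → ∀ v : Fin k → ℕ, ¬ Sat φ v → ¬ Sat φ (fun i => numM M (v i)) :=
    fun hφ' e hM v hv => (e M _).1 (hM.sat hφ' ((e ℕ v).2 hv))
  have snoc : ∀ {k : ℕ} (v : Fin k → ℕ) (x : ℕ),
      (Fin.snoc (fun i => numM M (v i)) (numM M x) : Fin (k + 1) → M) =
        fun i => numM M ((Fin.snoc v x : Fin (k + 1) → ℕ) i) := fun v x =>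
    (Fin.comp_snoc (numM M) v x).symm
  refine IsPi.rec (motive_1 := fun _ _ _ _ => True) (motive_2 := fun n k φ _ => PiCorrect n M →
    ∀ v : Fin k → ℕ, ¬ Sat φ v → ¬ Sat φ (fun i => numM M (v i)))
    (fun _ => trivial) (fun _ _ => trivial) (fun _ _ => trivial) (fun _ _ _ _ => trivial)
    (fun _ _ _ _ => trivial) (fun _ _ _ _ => trivial) ?_ ?_ ?_ ?_ ?_ ?_ hφ
  · exact fun hφ => neg (.ofDelta0 (hφ.imp .falsum)) fun _ _ _ => sat_not _ _
  · intro n k φ hφ _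
    obtain ⟨φ', hφ', e⟩ := sigma_pi_exists_neg.1 hφ
    exact neg hφ'.succ e
  · intro n k φ _ ih hM v hv H
    rw [sat_all] at hv H
    push Not at hv
    obtain ⟨x, hx⟩ := hv
    exact ih hM _ hx (snoc v x ▸ H (numM M x))
  · intro n k φ ψ _ _ ih₁ ih₂ hM v
    have := ih₁ hM v
    have := ih₂ hM v
    simp only [sat_inf]
    tauto
  · intro n k φ ψ _ _ ih₁ ih₂ hM v
    have := ih₁ hM v
    have := ih₂ hM v
    simp only [sat_sup]
    tauto
  · intro n k t φ _ ih hM v hv H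
    simp only [sat_ex, sat_inf, sat_leF, Function.comp_apply, evalT_var, Fin.snoc_last,
      evalT_liftT] at hv H
    push Not at hv
    obtain ⟨x, hx, hs⟩ := H
    rw [h.evalT_num] at hx
    obtain ⟨a, ha, rfl⟩ := h.exists_of_le_num hx
    exact ih hM _ (hv a ((leM_nat _ _).2 ha)) (snoc v a ▸ hs)

end Transfer

/-! ### The Rosser sentence -/

theorem snoc_const {α : Type} (x y : α) :
    (Fin.snoc (fun _ : Fin 1 => x) y : Fin 2 → α) = ![x, y] := by
  funext i
  fin_cases i <;> rfl

theorem exists_rosser {n : ℕ} {A B : LA.BoundedFormula Empty 2} (hA : IsPi n A) (hB : IsPi n B) :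
    ∃ γ : LA.BoundedFormula Empty 1, IsPi (n + 1) γ ∧ ∀ (M : Type) [LA.Structure M] (x : M),
      Sat γ (fun _ => x) ↔ ∀ p : M, Sat A ![x, p] → ∃ q, leM q p ∧ Sat B ![x, q] := by
  obtain ⟨A', hA', eA⟩ := sigma_pi_exists_neg.2 hA
  obtain ⟨B', hB', eB⟩ := hB.exists_subst (m := 3) ![varT 0, varT 2]
  refine ⟨_, ((IsPi.ofSigma hA').sup (.bdex (varT 1) hB'.succ)).all, fun M _ x => ?_⟩
  simp only [sat_all, sat_sup, sat_ex, sat_inf, sat_leF, eA M, eB M, snoc_const,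
    Function.comp_apply, evalT_var, Fin.snoc_last, evalT_liftT, evalT_varT, imp_iff_not_or]
  refine forall_congr' fun p => or_congr Iff.rfl (exists_congr fun q => and_congr Iff.rfl ?_)
  refine iff_of_eq (congrArg _ (funext fun i => ?_))
  fin_cases i <;> rfl

/-- A `Σ_{n+1}` set is the projection of a set defined by a `Πₙ`-formula. -/
theorem Sg.exists_pi {n : ℕ} {P : ℕ → Prop} (hP : Sg n P) : ∃ A : LA.BoundedFormula Empty 2,
    IsPi n A ∧ ∀ x, P x ↔ ∃ p, Sat A ![x, p] := by
  obtain ⟨φ, hφ, e⟩ := hP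
  obtain ⟨A, hA, e'⟩ := hφ.exists_normalForm
  refine ⟨A, hA, fun x => ?_⟩
  refine (e (fun _ => x)).symm.trans ?_
  rw [e']
  simp only [snoc_const]

theorem PiDefinable.sg {n : ℕ} {A : Set ℕ} (h : PiDefinable n A) : Sg n (fun c => c ∈ A) := by
  obtain ⟨Ψ, hΨ, e⟩ := h
  refine ⟨Ψ, .ofPi hΨ, fun v => ?_⟩
  refine Iff.trans ?_ (e (v 0)).symm
  refine iff_of_eq (congrArg₂ Ψ.Realize (Subsingleton.elim _ _) (funext fun i => ?_))
  fin_cases i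
  rfl

theorem Sg.ref_neg {n : ℕ} {Ax : ℕ → Prop} (hAx : Sg n Ax) :
    Sg n (fun x => Ref Ax (enc [neg (fx 1 x (Nat.pair 0 (nm x)))])) :=
  (Sg.ref hAx).comp
    (((Fn.const 1).fx Fn.id ((Fn.const 0).pair Fn.id.nm)).neg.lcons (Fn.const 0))

theorem Sg.ref_pos {n : ℕ} {Ax : ℕ → Prop} (hAx : Sg n Ax) :
    Sg n (fun x => Ref Ax (enc [pos (fx 1 x (Nat.pair 0 (nm x)))])) :=
  (Sg.ref hAx).comp
    (((Fn.const 1).fx Fn.id ((Fn.const 0).pair Fn.id.nm)).pos.lcons (Fn.const 0))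

/-- **Corollary 2.5.** No consistent, `Πₙ`-definable and `Πₙ`-complete
extension of `Q` is `Π_{n+1}`-deciding. -/
theorem consistent_piDefinable_piComplete_not_piSuccDeciding (n : ℕ) (T : LA.Theory)
    (hQ : ExtendsQ T) (hcon : Consistent T)
    (hdef : PiDefinable n (axiomCodes T))
    (hcomp : ∀ φ : LA.Sentence, IsPi n φ → ℕ ⊨ φ → Proves T φ) :
    ∃ γ : LA.Sentence, IsPi (n + 1) γ ∧ ¬ Proves T γ ∧ ¬ Proves T (∼γ) := by
  obtain ⟨A, hA, eA⟩ := hdef.sg.ref_neg.exists_pi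
  obtain ⟨B, hB, eB⟩ := hdef.sg.ref_pos.exists_pi
  obtain ⟨γ, hγ, eγ⟩ := exists_rosser hA hB
  set m := godel γ with hm
  have eA := (eA m).symm.trans (ref_neg_iff γ m)
  have eB := (eB m).symm.trans (ref_pos_iff γ m)
  obtain ⟨δ, hδ, eδ⟩ := hγ.exists_subst (m := 0) (fun _ => numT m)
  simp only [IsSubst, evalT_numT] at eδ
  have hrob : ∀ (M : Type) [LA.Structure M], SatT T M → IsRobinson M := fun M _ => hQ.isRobinson
  have hcor : ∀ (M : Type) [LA.Structure M], SatT T M → PiCorrect n M := fun M _ hM φ hφ h =>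
    proves_iff.1 (hcomp φ hφ ((congrArg (Sat φ) (Subsingleton.elim _ _)).mp h)) M hM
  have num : ∀ (M : Type) [LA.Structure M] (p : ℕ),
      (fun i => numM M ((![m, p] : Fin 2 → ℕ) i)) = ![numM M m, numM M p] := fun M _ p => by
    funext i
    fin_cases i <;> rfl
  have htrue : ∀ {φ : LA.BoundedFormula Empty 2}, IsPi n φ → ∀ {p : ℕ}, Sat φ ![m, p] →
      ∀ (M : Type) [LA.Structure M], SatT T M → Sat φ ![numM M m, numM M p] :=
    fun hφ p h M _ hM => num M p ▸ (hcor M hM).sat hφ h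
  have hfalse : ∀ {φ : LA.BoundedFormula Empty 2}, IsPi n φ → ∀ {p : ℕ}, ¬ Sat φ ![m, p] →
      ∀ (M : Type) [LA.Structure M], SatT T M → ¬ Sat φ ![numM M m, numM M p] :=
    fun hφ p h M _ hM => num M p ▸ (hrob M hM).not_sat hφ (hcor M hM) _ h
  obtain ⟨M, _, hM⟩ := hcon.exists_satT
  refine ⟨δ, hδ, fun h => ?_, fun h => ?_⟩
  · have h : ∀ (M : Type) [LA.Structure M], SatT T M → Sat γ (fun _ => numM M m) :=
      fun M _ hM => (eδ M _).1 (proves_iff.1 h M hM)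
    obtain ⟨p, hp⟩ := eA.2 h
    obtain ⟨q, hq, hs⟩ := (eγ M _).1 (h M hM) _ (htrue hA hp M hM)
    obtain ⟨a, -, rfl⟩ := (hrob M hM).exists_of_le_num hq
    exact hfalse hB (fun hB => eB.1 ⟨a, hB⟩ M hM (h M hM)) M hM hs
  · have h : ∀ (M : Type) [LA.Structure M], SatT T M → ¬ Sat γ (fun _ => numM M m) :=
      fun M _ hM H => proves_iff.1 h M hM ((eδ M _).2 H)
    obtain ⟨q, hq⟩ := eB.2 h
    refine h M hM ((eγ M _).2 fun p hp => ?_)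
    rcases (hrob M hM).le_total_num p q with hle | hle
    · obtain ⟨a, -, rfl⟩ := (hrob M hM).exists_of_le_num hle
      exact (hfalse hA (fun hA => h M hM (eA.1 ⟨a, hA⟩ M hM)) M hM hp).elim
    · exact ⟨_, hle, htrue hB hq M hM⟩

end GRNonRE
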